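/- Fix an integer j with 1 ≤ j ≤ Δ. For a Δ-tree T of order n, let X_n(T) denote the number of vertices of T of degree j (this is invariant under isomorphism, hence well defined on 𝒯_n^Δ), regarded as a random variable on 𝒯_n^Δ with the uniform distribution. Then there exists a real constant μ_j such that for every ε > 0, the probability (under the uniform measure on 𝒯_n^Δ) that |X_n − μ_j·n| ≤ ε·n tends to 1 as n → ∞. -/

import Mathlib

open Filter Topology MeasureTheory

namespace TreePaper

/-- The degree of a vertex `v` in a simple graph on `Fin n`. -/
noncomputable def degr {n : ℕ} (G : SimpleGraph (Fin n)) (v : Fin n) : ℕ :=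
  Nat.card {u : Fin n // G.Adj v u}

/-- A `Δ`-tree of order `n`: a tree on `n` vertices with all degrees at most `Δ`. -/
abbrev DTree (Δ n : ℕ) : Type :=
  {G : SimpleGraph (Fin n) // G.IsTree ∧ ∀ v, degr G v ≤ Δ}

instance treeSetoid (Δ n : ℕ) : Setoid (DTree Δ n) where
  r G H := Nonempty (G.1 ≃g H.1)
  iseqv :=
    ⟨fun G => ⟨SimpleGraph.Iso.refl⟩, fun ⟨e⟩ => ⟨e.symm⟩, fun ⟨e⟩ ⟨f⟩ => ⟨e.trans f⟩⟩

/-- Isomorphism classes of `Δ`-trees of order `n`. -/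
abbrev TClass (Δ n : ℕ) : Type := Quotient (treeSetoid Δ n)

/-- The number of vertices of degree `j` in `G`. -/
noncomputable def vcount {n : ℕ} (j : ℕ) (G : SimpleGraph (Fin n)) : ℕ :=
  Nat.card {v : Fin n // degr G v = j}

/-- The number of vertices of degree `j`, as a random variable on iso classes. -/
noncomputable def Xdeg (Δ n j : ℕ) (c : TClass Δ n) : ℕ :=
  vcount j (Quotient.out c).1

/-- Probability of an event under the uniform measure on iso classes of `Δ`-trees. -/
noncomputable def prob (Δ n : ℕ) (P : TClass Δ n → Prop) : ℝ :=
  (Nat.card {c : TClass Δ n // P c} : ℝ) / (Nat.card (TClass Δ n) : ℝ)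

/-- Expectation under the uniform measure on iso classes of `Δ`-trees. -/
noncomputable def mean (Δ n : ℕ) (f : TClass Δ n → ℝ) : ℝ :=
  (∑ᶠ c : TClass Δ n, f c) / (Nat.card (TClass Δ n) : ℝ)

/-- Variance under the uniform measure on iso classes of `Δ`-trees. -/
noncomputable def variance (Δ n : ℕ) (f : TClass Δ n → ℝ) : ℝ :=
  (∑ᶠ c : TClass Δ n, (f c - mean Δ n f) ^ 2) / (Nat.card (TClass Δ n) : ℝ)

/-- The standard normal distribution function. -/
noncomputable def stdNormalCDF (t : ℝ) : ℝ :=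
  (Real.sqrt (2 * Real.pi))⁻¹ * ∫ s in Set.Iic t, Real.exp (-(s ^ 2) / 2)

end TreePaper

namespace TreePaper

noncomputable instance : QPF Multiset.{0} where
  P := ⟨ℕ, Fin⟩
  abs p := Multiset.ofList (List.ofFn p.2)
  repr s := ⟨s.toList.length, s.toList.get⟩
  abs_repr s := by
    change ((List.ofFn s.toList.get : List _) : Multiset _) = s
    rw [List.ofFn_get, Multiset.coe_toList]
  abs_map f p := by
    change ((List.ofFn (f ∘ p.2) : List _) : Multiset _) =
      Multiset.map f ((List.ofFn p.2 : List _) : Multiset _)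
    rw [Multiset.map_coe, List.map_ofFn]

/-- Finite unordered rooted trees: a tree is determined by the multiset of its root branches. -/
def RTree : Type := QPF.Fix Multiset

namespace RTree

/-- The tree with the given multiset of root branches. -/
noncomputable def mk (m : Multiset RTree) : RTree := QPF.Fix.mk m

/-- The multiset of root branches of a tree. -/
noncomputable def children (t : RTree) : Multiset RTree := QPF.Fix.dest t

@[simp] theorem mk_children (t : RTree) : mk t.children = t := QPF.Fix.mk_dest t

@[simp] theorem children_mk (m : Multiset RTree) : (mk m).children = m := QPF.Fix.dest_mk m

theorem mk_injective : Function.Injective mk := fun a b h => by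
  simpa using congrArg children h

theorem ind {p : RTree → Prop} (h : ∀ m : Multiset RTree, (∀ t ∈ m, p t) → p (mk m))
    (t : RTree) : p t := by
  refine QPF.Fix.ind p (fun m hm => h m ?_) t
  obtain ⟨u, rfl⟩ := hm
  intro t ht
  obtain ⟨a, -, rfl⟩ := Multiset.mem_map.1 ht
  exact a.2

/-- The sum over all nodes of a tree of a weight depending on the number of branches. -/
noncomputable def nodeSum (φ : ℕ → ℕ) : RTree → ℕ :=
  QPF.Fix.rec (F := Multiset) fun s : Multiset ℕ => φ s.card + s.sum

theorem nodeSum_mk (φ : ℕ → ℕ) (m : Multiset RTree) :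
    nodeSum φ (mk m) = φ m.card + (m.map (nodeSum φ)).sum := by
  refine (QPF.Fix.rec_eq (F := Multiset) (fun s : Multiset ℕ => φ s.card + s.sum) m).trans ?_
  change φ (Multiset.map (nodeSum φ) m).card + _ = _
  rw [Multiset.card_map]
  rfl

/-- The number of nodes of a tree. -/
noncomputable def size (t : RTree) : ℕ := nodeSum (fun _ => 1) t

/-- The number of nodes of a tree having exactly `i - 1` branches. -/
noncomputable def count (i : ℕ) (t : RTree) : ℕ := nodeSum (fun k => if k + 1 = i then 1 else 0) t

theorem size_mk (m : Multiset RTree) : size (mk m) = 1 + (m.map size).sum := nodeSum_mk _ m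

theorem count_mk (i : ℕ) (m : Multiset RTree) :
    count i (mk m) = (if m.card + 1 = i then 1 else 0) + (m.map (count i)).sum := nodeSum_mk _ m

theorem size_pos (t : RTree) : 0 < size t := by
  rw [← mk_children t, size_mk]; omega

theorem size_lt_of_mem {t : RTree} {m : Multiset RTree} (h : t ∈ m) : size t < size (mk m) := by
  rw [size_mk]
  have := Multiset.single_le_sum (fun x _ => Nat.zero_le x) _ (Multiset.mem_map_of_mem size h)
  omega

theorem count_le_size (i : ℕ) (t : RTree) : count i t ≤ size t := by
  induction t using ind with
  | h m ih =>
    rw [count_mk, size_mk]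
    have := Multiset.sum_map_le_sum_map _ _ ih
    split_ifs <;> omega

end RTree

open Classical in
/-- The multisets of cardinality `k` with all elements in `T`. -/
noncomputable def msets {α : Type*} (T : Finset α) (k : ℕ) : Finset (Multiset α) :=
  (T.sym k).image Sym.toMultiset

theorem mem_msets {α : Type*} {T : Finset α} {k : ℕ} {m : Multiset α} :
    m ∈ msets T k ↔ m.card = k ∧ ∀ a ∈ m, a ∈ T := by
  classical
  unfold msets
  simp only [Finset.mem_image, Finset.mem_sym_iff]
  constructor
  · rintro ⟨s, hs, rfl⟩
    exact ⟨s.2, fun a ha => hs a (Sym.mem_coe.1 ha)⟩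
  · rintro ⟨h, hm⟩
    exact ⟨⟨m, h⟩, fun a ha => hm a (Sym.mem_coe.2 ha), rfl⟩

/-- The complete homogeneous symmetric polynomial of the weights `w a`, `a ∈ T`. -/
noncomputable def hsum {α : Type*} (T : Finset α) (w : α → ℝ) (k : ℕ) : ℝ :=
  ∑ m ∈ msets T k, (m.map w).prod

theorem hsum_zero {α : Type*} (T : Finset α) (w : α → ℝ) : hsum T w 0 = 1 := by
  have : msets T 0 = {0} := by
    ext m; simp +contextual [mem_msets]
  simp [hsum, this]

/-- Newton's identity for complete homogeneous symmetric polynomials. -/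
theorem mul_hsum {α : Type*} (T : Finset α) (w : α → ℝ) (k : ℕ) :
    k * hsum T w k = ∑ i ∈ Finset.Icc 1 k, (∑ a ∈ T, w a ^ i) * hsum T w (k - i) := by
  classical
  have h1 : ∀ a ∈ T, ∀ i ∈ Finset.Icc 1 k,
      w a ^ i * hsum T w (k - i) =
        ∑ m ∈ msets T k, if i ≤ m.count a then (m.map w).prod else 0 := by
    intro a ha i hi
    rw [Finset.mem_Icc] at hi
    rw [← Finset.sum_filter, hsum, Finset.mul_sum]
    refine Finset.sum_bij' (fun m _ => m + Multiset.replicate i a)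
      (fun m _ => m - Multiset.replicate i a) ?_ ?_ ?_ ?_ ?_
    · intro m hm
      rw [mem_msets] at hm
      simp only [Finset.mem_filter, mem_msets, Multiset.card_add, Multiset.card_replicate,
        Multiset.mem_add, Multiset.count_add, Multiset.count_replicate_self]
      refine ⟨⟨by omega, ?_⟩, by omega⟩
      rintro b (hb | hb)
      · exact hm.2 b hb
      · rw [Multiset.eq_of_mem_replicate hb]; exact ha
    · intro m hm
      simp only [Finset.mem_filter, mem_msets] at hm
      rw [mem_msets, Multiset.card_sub (Multiset.le_count_iff_replicate_le.1 hm.2),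
        Multiset.card_replicate]
      exact ⟨by omega, fun b hb => hm.1.2 b (Multiset.mem_of_le (Multiset.sub_le_self _ _) hb)⟩
    · intro m _
      simp
    · intro m hm
      simp only [Finset.mem_filter] at hm
      exact tsub_add_cancel_of_le (Multiset.le_count_iff_replicate_le.1 hm.2)
    · intro m _
      simp [mul_comm]
  simp_rw [Finset.sum_mul]
  rw [Finset.sum_congr rfl fun i hi => Finset.sum_congr rfl fun a ha => h1 a ha i hi]
  rw [Finset.sum_comm]
  simp_rw [Finset.sum_comm (s := Finset.Icc 1 k)]
  rw [Finset.sum_comm, hsum, Finset.mul_sum]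
  refine Finset.sum_congr rfl fun m hm => ?_
  rw [mem_msets] at hm
  have h2 : ∀ a ∈ T, (∑ i ∈ Finset.Icc 1 k, if i ≤ m.count a then (m.map w).prod else 0)
      = m.count a * (m.map w).prod := by
    intro a _
    rw [← Finset.sum_filter, Finset.sum_const, nsmul_eq_mul]
    congr 2
    have : (Finset.Icc 1 k).filter (fun i => i ≤ m.count a) = Finset.Icc 1 (m.count a) := by
      ext i
      have := Multiset.count_le_card a m
      simp only [Finset.mem_filter, Finset.mem_Icc]
      omega
    rw [this]; simp
  rw [Finset.sum_congr rfl h2, ← Finset.sum_mul, ← Nat.cast_sum]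
  congr 2
  rw [← hm.1, Multiset.sum_count_eq_card]
  exact hm.2

/-- The values of complete homogeneous symmetric polynomials in terms of power sums. -/
noncomputable def newtonH (p : ℕ → ℝ) : ℕ → ℝ
  | 0 => 1
  | k + 1 => (∑ i : Fin (k + 1), p (i + 1) * newtonH p (k - i)) / (k + 1)

theorem hsum_eq_newtonH {α : Type*} (T : Finset α) (w : α → ℝ) (k : ℕ) :
    hsum T w k = newtonH (fun i => ∑ a ∈ T, w a ^ i) k := by
  induction k using Nat.strong_induction_on with
  | _ k ih =>
    cases k with
    | zero => rw [hsum_zero, newtonH]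
    | succ k =>
      rw [newtonH, eq_div_iff (by positivity), mul_comm]
      have := mul_hsum T w (k + 1)
      push_cast at this
      rw [this, ← Finset.sum_range (fun i => (∑ a ∈ T, w a ^ (i + 1)) *
        newtonH (fun i => ∑ a ∈ T, w a ^ i) (k - i)), Finset.range_eq_Ico]
      have hI : Finset.Icc 1 (k + 1) = Finset.Ico (0 + 1) (k + 1 + 1) := by
        ext i; simp only [Finset.mem_Icc, Finset.mem_Ico]; omega
      rw [hI, ← Finset.sum_Ico_add' _ 0 (k + 1) 1]
      refine Finset.sum_congr rfl fun i _ => ?_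
      rw [Nat.add_sub_add_right, ih _ (by omega)]

open RTree

open Classical in
/-- Trees of height less than `h` in which every node has fewer than `Δ` branches. -/
noncomputable def level (Δ : ℕ) : ℕ → Finset RTree
  | 0 => ∅
  | h + 1 => (Finset.range Δ).biUnion fun k => (msets (level Δ h) k).image mk

theorem mk_mem_level_succ {Δ h : ℕ} {m : Multiset RTree} :
    mk m ∈ level Δ (h + 1) ↔ m.card < Δ ∧ ∀ a ∈ m, a ∈ level Δ h := by
  classical
  rw [level]
  simp only [Finset.mem_biUnion, Finset.mem_range, Finset.mem_image, mem_msets]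
  constructor
  · rintro ⟨k, hk, m', ⟨rfl, h'⟩, e⟩
    rw [mk_injective e] at *
    exact ⟨hk, h'⟩
  · rintro ⟨h1, h2⟩
    exact ⟨_, h1, m, ⟨rfl, h2⟩, rfl⟩

theorem level_subset_succ (Δ h : ℕ) : level Δ h ⊆ level Δ (h + 1) := by
  induction h with
  | zero => simp [level]
  | succ h ih =>
    intro t ht
    rw [← mk_children t] at ht ⊢
    rw [mk_mem_level_succ] at ht ⊢
    exact ⟨ht.1, fun a ha => ih (ht.2 a ha)⟩

theorem level_mono (Δ : ℕ) : Monotone (level Δ) := monotone_nat_of_le_succ (level_subset_succ Δ)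

/-- Every node of the tree has fewer than `Δ` branches. -/
def Valid (Δ : ℕ) (t : RTree) : Prop := ∃ h, t ∈ level Δ h

theorem Valid.mem_level {Δ : ℕ} {t : RTree} (ht : Valid Δ t) : t ∈ level Δ t.size := by
  induction t using RTree.ind with
  | h m ih =>
    obtain ⟨h, hh⟩ := ht
    cases h with
    | zero => simp [level] at hh
    | succ h =>
      rw [mk_mem_level_succ] at hh
      obtain ⟨n, hn⟩ : ∃ n, size (mk m) = n + 1 := ⟨_, by rw [size_mk, add_comm]⟩
      rw [hn, mk_mem_level_succ]
      refine ⟨hh.1, fun a ha => level_mono Δ ?_ (ih a ha ⟨h, hh.2 a ha⟩)⟩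
      have := size_lt_of_mem ha
      omega

theorem valid_mk {Δ : ℕ} {m : Multiset RTree} :
    Valid Δ (mk m) ↔ m.card < Δ ∧ ∀ a ∈ m, Valid Δ a := by
  constructor
  · rintro ⟨h, hh⟩
    cases h with
    | zero => simp [level] at hh
    | succ h =>
      rw [mk_mem_level_succ] at hh
      exact ⟨hh.1, fun a ha => ⟨h, hh.2 a ha⟩⟩
  · rintro ⟨h1, h2⟩
    refine ⟨size (mk m) + 1, mk_mem_level_succ.2 ⟨h1, fun a ha => ?_⟩⟩
    exact level_mono Δ (size_lt_of_mem ha).le (h2 a ha).mem_level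

open Classical in
/-- The trees with `n` nodes in which every node has fewer than `Δ` branches. -/
noncomputable def treesOfSize (Δ n : ℕ) : Finset RTree := (level Δ n).filter fun t => t.size = n

theorem mem_treesOfSize {Δ n : ℕ} {t : RTree} :
    t ∈ treesOfSize Δ n ↔ Valid Δ t ∧ t.size = n := by
  classical
  rw [treesOfSize, Finset.mem_filter]
  constructor
  · rintro ⟨h, h'⟩; exact ⟨⟨n, h⟩, h'⟩
  · rintro ⟨h, rfl⟩; exact ⟨h.mem_level, rfl⟩

theorem sum_level_succ (Δ h : ℕ) (f : RTree → ℝ) :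
    ∑ t ∈ level Δ (h + 1), f t =
      ∑ k ∈ Finset.range Δ, ∑ m ∈ msets (level Δ h) k, f (mk m) := by
  classical
  rw [level, Finset.sum_biUnion]
  · refine Finset.sum_congr rfl fun k _ => ?_
    rw [Finset.sum_image fun _ _ _ _ h => mk_injective h]
  · intro k _ l _ hkl
    rw [Function.onFun, Finset.disjoint_left]
    intro t ht ht'
    obtain ⟨m, hm, rfl⟩ := Finset.mem_image.1 ht
    obtain ⟨m', hmk, e⟩ := Finset.mem_image.1 ht'
    rw [mk_injective e, mem_msets] at hmk
    rw [mem_msets] at hm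
    exact hkl (hm.1.symm.trans hmk.1)

/-- The weight `exp (s * X - r * N)` of a tree with `N` nodes, `X` of them of total degree `j`. -/
noncomputable def wt (j : ℕ) (s r : ℝ) (t : RTree) : ℝ := Real.exp (s * count j t - r * size t)

theorem wt_pos (j : ℕ) (s r : ℝ) (t : RTree) : 0 < wt j s r t := Real.exp_pos _

theorem wt_mk (j : ℕ) (s r : ℝ) (m : Multiset RTree) :
    wt j s r (mk m) =
      Real.exp (s * (if m.card + 1 = j then 1 else 0) - r) * (m.map (wt j s r)).prod := by
  have h : ∀ m : Multiset RTree, (m.map (wt j s r)).prod =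
      Real.exp (s * ((m.map (count j)).sum : ℕ) - r * ((m.map size).sum : ℕ)) := by
    intro m
    induction m using Multiset.induction with
    | empty => simp
    | cons a m ih =>
      simp only [Multiset.map_cons, Multiset.prod_cons, Multiset.sum_cons, ih, wt,
        ← Real.exp_add]
      congr 1; push_cast; ring
  rw [h, wt, ← Real.exp_add, count_mk, size_mk]
  congr 1; push_cast; ring

theorem sum_level_succ_wt (Δ j h : ℕ) (s r : ℝ) :
    ∑ t ∈ level Δ (h + 1), wt j s r t = ∑ k ∈ Finset.range Δ,
      Real.exp (s * (if k + 1 = j then 1 else 0) - r) * hsum (level Δ h) (wt j s r) k := by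
  rw [sum_level_succ]
  refine Finset.sum_congr rfl fun k _ => ?_
  rw [hsum, Finset.mul_sum]
  refine Finset.sum_congr rfl fun m hm => ?_
  rw [wt_mk, (mem_msets.1 hm).1]

theorem hsum_nonneg {α : Type*} (T : Finset α) (w : α → ℝ) (hw : ∀ a, 0 ≤ w a) (k : ℕ) :
    0 ≤ hsum T w k :=
  Finset.sum_nonneg fun m _ => Multiset.prod_nonneg fun x hx => by
    obtain ⟨a, -, rfl⟩ := Multiset.mem_map.1 hx
    exact hw a

theorem newtonH_nonneg {p : ℕ → ℝ} (hp : ∀ i, 0 ≤ p i) (k : ℕ) : 0 ≤ newtonH p k := by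
  induction k using Nat.strong_induction_on with
  | _ k ih =>
    cases k with
    | zero => rw [newtonH]; exact zero_le_one
    | succ k =>
      rw [newtonH]
      exact div_nonneg (Finset.sum_nonneg fun i _ => mul_nonneg (hp _) (ih _ (by omega)))
        (by positivity)

theorem newtonH_mono {p q : ℕ → ℝ} (hp : ∀ i, 0 ≤ p i) (k : ℕ)
    (hpq : ∀ i, 1 ≤ i → i ≤ k → p i ≤ q i) :
    newtonH p k ≤ newtonH q k := by
  induction k using Nat.strong_induction_on with
  | _ k ih =>
    cases k with
    | zero => rw [newtonH, newtonH]
    | succ k =>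
      rw [newtonH, newtonH]
      gcongr with i
      · exact newtonH_nonneg hp _
      · exact (hp _).trans (hpq _ (by omega) (by omega))
      · exact hpq _ (by omega) (by omega)
      · exact ih _ (by omega) fun l h1 h2 => hpq l h1 (by omega)

theorem newtonH_le_one {p : ℕ → ℝ} (hp : ∀ i, 0 ≤ p i) (hp1 : ∀ i, 1 ≤ i → p i ≤ 1) (k : ℕ) :
    newtonH p k ≤ 1 := by
  induction k using Nat.strong_induction_on with
  | _ k ih =>
    cases k with
    | zero => rw [newtonH]
    | succ k =>
      rw [newtonH, div_le_one (by positivity)]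
      calc _ ≤ ∑ i : Fin (k + 1), (1 : ℝ) := Finset.sum_le_sum fun i _ =>
            mul_le_one₀ (hp1 _ (by omega)) (newtonH_nonneg hp _) (ih _ (by omega))
        _ = _ := by simp

theorem sum_level_log_le_one {Δ : ℕ} (hΔ : 1 ≤ Δ) (h : ℕ) :
    ∑ t ∈ level Δ h, wt 0 0 (Real.log Δ) t ≤ 1 := by
  have hpos : (0 : ℝ) < Δ := by exact_mod_cast hΔ
  induction h with
  | zero => simp [level]
  | succ h ih =>
    rw [sum_level_succ_wt]
    have hw1 : ∀ t, wt 0 0 (Real.log Δ) t ≤ 1 := fun t => by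
      rw [wt, Real.exp_le_one_iff]
      have := Real.log_nonneg (show (1 : ℝ) ≤ Δ by exact_mod_cast hΔ)
      have : 0 ≤ Real.log Δ * size t := by positivity
      linarith
    calc _ ≤ ∑ k ∈ Finset.range Δ, (Δ : ℝ)⁻¹ * 1 := by
          refine Finset.sum_le_sum fun k _ => ?_
          rw [zero_mul, zero_sub, Real.exp_neg, Real.exp_log hpos, hsum_eq_newtonH]
          gcongr
          refine newtonH_le_one (fun i => Finset.sum_nonneg fun t _ => pow_nonneg (wt_pos ..).le _)
            (fun i hi => le_trans (Finset.sum_le_sum fun t _ => ?_) ih) k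
          exact pow_le_of_le_one (wt_pos ..).le (hw1 t) (by omega)
      _ = 1 := by simp [hpos.ne']

theorem card_treesOfSize_le {Δ : ℕ} (hΔ : 1 ≤ Δ) (n : ℕ) :
    ((treesOfSize Δ n).card : ℝ) ≤ Real.exp (Real.log Δ * n) := by
  classical
  have h1 := sum_level_log_le_one hΔ n
  have h2 : ∑ t ∈ treesOfSize Δ n, wt 0 0 (Real.log Δ) t ≤ 1 :=
    le_trans (Finset.sum_le_sum_of_subset_of_nonneg (Finset.filter_subset _ _)
      fun t _ _ => (wt_pos ..).le) h1
  have h3 : ∑ t ∈ treesOfSize Δ n, wt 0 0 (Real.log Δ) t =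
      (treesOfSize Δ n).card * Real.exp (-(Real.log Δ * n)) := by
    rw [← nsmul_eq_mul, ← Finset.sum_const]
    refine Finset.sum_congr rfl fun t ht => ?_
    rw [wt, (mem_treesOfSize.1 ht).2]; congr 1; ring
  rw [h3, Real.exp_neg, ← div_eq_mul_inv, div_le_one (Real.exp_pos _)] at h2
  exact h2

theorem card_treesOfSize_mul_le {Δ : ℕ} (hΔ : 3 ≤ Δ) (m n : ℕ) :
    (treesOfSize Δ m).card * (treesOfSize Δ n).card ≤ 2 * (treesOfSize Δ (m + n + 1)).card := by
  classical
  rw [← Finset.card_product, mul_comm]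
  refine Finset.card_le_mul_card_image_of_maps_to
    (f := fun x : RTree × RTree => mk {x.1, x.2}) ?_ 2 ?_ |>.trans_eq (mul_comm _ _)
  · rintro ⟨a, b⟩ hab
    simp only [Finset.mem_product, mem_treesOfSize] at hab
    simp only [mem_treesOfSize, valid_mk, size_mk]
    refine ⟨⟨by simp; omega, ?_⟩, ?_⟩
    · intro c hc
      simp only [Multiset.insert_eq_cons, Multiset.mem_cons, Multiset.mem_singleton] at hc
      rcases hc with rfl | rfl
      exacts [hab.1.1, hab.2.1]
    · simp; omega
  · intro t _
    by_cases hne : ∃ x : RTree × RTree, mk {x.1, x.2} = t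
    · obtain ⟨⟨a, b⟩, rfl⟩ := hne
      refine (Finset.card_le_card (t := {(a, b), (b, a)}) ?_).trans Finset.card_le_two
      rintro ⟨c, d⟩ hx
      have e := mk_injective (Finset.mem_filter.1 hx).2
      simp only [Multiset.insert_eq_cons] at e
      have e' : ({c, d} : Multiset RTree) = {a, b} := e
      rw [Multiset.cons_eq_cons] at e
      rcases e with ⟨rfl, e⟩ | ⟨_, cs, e1, e2⟩
      · simp at e; simp [e]
      · have hc : cs = 0 := by
          have := congrArg Multiset.card e1
          simp at this; exact this
        subst hc
        simp at e1 e2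
        simp [e1, e2]
    · push Not at hne
      rw [Finset.filter_false_of_mem fun x _ => hne x]
      simp

theorem card_treesOfSize_le_succ {Δ : ℕ} (hΔ : 2 ≤ Δ) (n : ℕ) :
    (treesOfSize Δ n).card ≤ (treesOfSize Δ (n + 1)).card := by
  refine Finset.card_le_card_of_injOn (fun t => mk {t}) ?_ ?_
  · intro t ht
    rw [Finset.mem_coe, mem_treesOfSize] at ht
    rw [Finset.mem_coe, mem_treesOfSize, valid_mk, size_mk]
    refine ⟨⟨by simp; omega, by simpa using ht.1⟩, by simp; omega⟩
  · intro a _ b _ h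
    simpa using mk_injective h

theorem one_le_card_treesOfSize {Δ : ℕ} (hΔ : 2 ≤ Δ) (n : ℕ) :
    1 ≤ (treesOfSize Δ (n + 1)).card := by
  induction n with
  | zero =>
    refine Finset.card_pos.2 ⟨mk 0, mem_treesOfSize.2 ⟨valid_mk.2 ⟨by simp; omega, by simp⟩, ?_⟩⟩
    simp [size_mk]
  | succ n ih => exact ih.trans (card_treesOfSize_le_succ hΔ _)

theorem three_le_card_treesOfSize_four {Δ : ℕ} (hΔ : 3 ≤ Δ) : 3 ≤ (treesOfSize Δ 4).card := by
  classical
  have h : ({mk {mk {mk {mk 0}}}, mk {mk {mk 0, mk 0}}, mk {mk 0, mk {mk 0}}} : Finset RTree) ⊆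
      treesOfSize Δ 4 := by
    intro t ht
    simp only [Finset.mem_insert, Finset.mem_singleton] at ht
    rcases ht with rfl | rfl | rfl <;>
    simp [mem_treesOfSize, valid_mk, size_mk] <;> omega
  refine le_trans ?_ (Finset.card_le_card h)
  rw [Finset.card_insert_of_notMem, Finset.card_insert_of_notMem, Finset.card_singleton]
  · simp only [Finset.mem_singleton]
    intro e
    simpa using congrArg Multiset.card (mk_injective e)
  · simp only [Finset.mem_insert, Finset.mem_singleton]
    rintro (e | e)
    · have := Multiset.singleton_inj.1 (mk_injective e)
      simpa using congrArg Multiset.card (mk_injective this)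
    · simpa using congrArg Multiset.card (mk_injective e)

/-- A subadditive modification of `-log` of the number of trees with `n - 1` nodes. -/
noncomputable def logSeq (Δ n : ℕ) : ℝ :=
  if n = 0 then 0 else Real.log 2 - Real.log (max (treesOfSize Δ (n - 1)).card 1 : ℕ)

theorem max_card_mul_le {Δ : ℕ} (hΔ : 3 ≤ Δ) (m n : ℕ) :
    max (treesOfSize Δ m).card 1 * max (treesOfSize Δ n).card 1 ≤
      2 * max (treesOfSize Δ (m + n + 1)).card 1 := by
  have h0 : (treesOfSize Δ 0).card = 0 := by
    rw [Finset.card_eq_zero, Finset.eq_empty_iff_forall_notMem]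
    intro t ht
    have := size_pos t
    have := (mem_treesOfSize.1 ht).2
    omega
  have h1 : ∀ n, max (treesOfSize Δ n).card 1 ≤ 2 * max (treesOfSize Δ (n + 1)).card 1 := by
    intro n
    have := card_treesOfSize_le_succ (by omega : 2 ≤ Δ) n
    omega
  rcases m with _ | m
  · rw [h0, zero_add]; simpa using h1 n
  rcases n with _ | n
  · rw [h0, add_zero]; simpa using h1 (m + 1)
  rw [max_eq_left (one_le_card_treesOfSize (by omega) m),
    max_eq_left (one_le_card_treesOfSize (by omega) n),
    max_eq_left (one_le_card_treesOfSize (by omega) (m + 1 + (n + 1)))]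
  exact card_treesOfSize_mul_le hΔ _ _

theorem subadditive_logSeq {Δ : ℕ} (hΔ : 3 ≤ Δ) : Subadditive (logSeq Δ) := by
  intro m n
  rcases m with _ | m
  · simp [logSeq]
  rcases n with _ | n
  · simp [logSeq]
  have h := max_card_mul_le hΔ m n
  simp only [logSeq, if_neg (Nat.succ_ne_zero _), Nat.add_sub_cancel,
    show m + 1 + (n + 1) = (m + n + 1) + 1 by ring]
  have pos : ∀ n, (0 : ℝ) < (max (treesOfSize Δ n).card 1 : ℕ) := fun n => by
    exact_mod_cast lt_of_lt_of_le one_pos (le_max_right _ _)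
  have h' : ((max (treesOfSize Δ m).card 1 : ℕ) : ℝ) * (max (treesOfSize Δ n).card 1 : ℕ) ≤
      2 * (max (treesOfSize Δ (m + n + 1)).card 1 : ℕ) := by exact_mod_cast h
  have := Real.log_le_log (mul_pos (pos m) (pos n)) h'
  rw [Real.log_mul (pos m).ne' (pos n).ne', Real.log_mul two_ne_zero (pos _).ne'] at this
  linarith

theorem exists_growth_rate {Δ : ℕ} (hΔ : 3 ≤ Δ) : ∃ lam : ℝ, 0 < lam ∧
    (∀ n : ℕ, ((treesOfSize Δ n).card : ℝ) ≤ 2 * Real.exp (lam * (n + 1))) ∧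
    ∀ ε : ℝ, 0 < ε → ∀ᶠ n : ℕ in atTop,
      Real.exp ((lam - ε) * n) ≤ ((treesOfSize Δ n).card : ℝ) := by
  have hlog : 0 ≤ Real.log Δ := Real.log_natCast_nonneg Δ
  have hlog2 : 0 ≤ Real.log 2 := Real.log_nonneg one_le_two
  have hbdd : BddBelow (Set.range fun n => logSeq Δ n / n) := by
    refine ⟨-Real.log Δ, ?_⟩
    rintro _ ⟨n, rfl⟩
    rcases n with _ | n
    · simp [logSeq, hlog]
    rw [le_div_iff₀ (by positivity), logSeq, if_neg (Nat.succ_ne_zero _), Nat.add_sub_cancel]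
    have h1 : ((max (treesOfSize Δ n).card 1 : ℕ) : ℝ) ≤ Real.exp (Real.log Δ * n) := by
      push_cast
      refine max_le (card_treesOfSize_le (by omega) n) (Real.one_le_exp (by positivity))
    have h2 := Real.log_le_log (by positivity) h1
    rw [Real.log_exp] at h2
    push_cast at h2 ⊢
    nlinarith
  have hs := subadditive_logSeq hΔ
  have hpos : ∀ n, (0 : ℝ) < (max (treesOfSize Δ n).card 1 : ℕ) := fun n => by
    exact_mod_cast lt_of_lt_of_le one_pos (le_max_right _ _)
  refine ⟨-hs.lim, ?_, ?_, ?_⟩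
  · have h1 := hs.lim_le_div hbdd (n := 5) (by norm_num)
    have h2 : logSeq Δ 5 < 0 := by
      rw [logSeq, if_neg (by norm_num), sub_neg]
      have h3 := three_le_card_treesOfSize_four hΔ
      refine Real.log_lt_log two_pos ?_
      exact_mod_cast lt_of_lt_of_le (by omega) (le_max_left (treesOfSize Δ 4).card 1)
    have : logSeq Δ 5 / (5 : ℕ) < 0 := div_neg_of_neg_of_pos h2 (by norm_num)
    linarith
  · intro n
    have h1 := hs.lim_le_div hbdd (n := n + 1) (by omega)
    rw [le_div_iff₀ (by positivity), logSeq, if_neg (Nat.succ_ne_zero _), Nat.add_sub_cancel] at h1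
    push_cast at h1
    have h2 : Real.log (max (treesOfSize Δ n).card 1 : ℕ) ≤ Real.log 2 + -hs.lim * (n + 1) := by
      push_cast
      linarith
    rw [Real.log_le_iff_le_exp (hpos n), Real.exp_add, Real.exp_log two_pos] at h2
    refine le_trans ?_ h2
    exact_mod_cast le_max_left _ _
  · intro ε hε
    have h1 := (hs.tendsto_lim hbdd).comp (tendsto_add_atTop_nat 1)
    have h2 := h1.eventually (gt_mem_nhds (show hs.lim < hs.lim + ε / 2 by linarith))
    obtain ⟨N, hN⟩ := exists_nat_gt ((Real.log 2 + |hs.lim + ε / 2|) / (ε / 2))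
    filter_upwards [h2, eventually_ge_atTop (N + 1)] with n hn hnN
    simp only [Function.comp] at hn
    rw [div_lt_iff₀ (by positivity), logSeq, if_neg (Nat.succ_ne_zero _), Nat.add_sub_cancel] at hn
    obtain ⟨k, rfl⟩ : ∃ k, n = k + 1 := ⟨n - 1, by omega⟩
    rw [max_eq_left (one_le_card_treesOfSize (by omega) k)] at hn
    rw [← Real.le_log_iff_exp_le (by exact_mod_cast one_le_card_treesOfSize (by omega) k)]
    have h3 : ((N : ℕ) : ℝ) ≤ (k + 1 : ℕ) := by exact_mod_cast by omega
    rw [div_lt_iff₀ (by positivity)] at hN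
    have h4 : (N : ℝ) * (ε / 2) ≤ (k + 1 : ℕ) * (ε / 2) := by gcongr
    have h5 := le_abs_self (hs.lim + ε / 2)
    push_cast at *
    nlinarith

theorem sum_level_quadratic {Δ : ℕ} (hΔ : 3 ≤ Δ) (h : ℕ) (r : ℝ) :
    Real.exp (-r) / 2 * (∑ t ∈ level Δ h, wt 0 0 r t) ^ 2 ≤
      ∑ t ∈ level Δ (h + 1), wt 0 0 r t := by
  rw [sum_level_succ_wt]
  have hn := hsum_nonneg (level Δ h) (wt 0 0 r) fun a => (wt_pos ..).le
  refine le_trans ?_ (Finset.single_le_sum (fun k _ => mul_nonneg (Real.exp_pos _).le (hn k))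
    (Finset.mem_range.2 (show 2 < Δ by omega)))
  have h1 := mul_hsum (level Δ h) (wt 0 0 r) 1
  have h2 := mul_hsum (level Δ h) (wt 0 0 r) 2
  have e : Finset.Icc 1 2 = {1, 2} := rfl
  simp only [Finset.Icc_self, Finset.sum_singleton, e] at h1 h2
  rw [Finset.sum_pair (by norm_num)] at h2
  simp only [pow_one, Nat.sub_self, hsum_zero, Nat.cast_one, one_mul, mul_one] at h1 h2
  norm_num at h2
  rw [h1] at h2
  have h3 : 0 ≤ ∑ t ∈ level Δ h, wt 0 0 r t ^ 2 := Finset.sum_nonneg fun _ _ => sq_nonneg _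
  rw [zero_mul, zero_sub, div_mul_eq_mul_div, mul_div_assoc]
  gcongr
  linarith

/-- The generating function of trees is bounded up to and including its radius of convergence. -/
theorem sum_level_le_of_growth {Δ : ℕ} (hΔ : 3 ≤ Δ) {lam : ℝ}
    (hl : ∀ n : ℕ, ((treesOfSize Δ n).card : ℝ) ≤ 2 * Real.exp (lam * (n + 1))) (h : ℕ) :
    ∑ t ∈ level Δ h, wt 0 0 lam t ≤ 2 * Real.exp lam := by
  classical
  have key : ∀ r > lam, ∑ t ∈ level Δ h, wt 0 0 r t ≤ 2 * Real.exp r := by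
    intro r hr
    have hb : BddAbove (Set.range fun h => ∑ t ∈ level Δ h, wt 0 0 r t) := by
      refine ⟨∑' n : ℕ, 2 * Real.exp lam * Real.exp (lam - r) ^ n, ?_⟩
      rintro _ ⟨h, rfl⟩
      have hsum : Summable fun n : ℕ => 2 * Real.exp lam * Real.exp (lam - r) ^ n :=
        (summable_geometric_of_lt_one (Real.exp_pos _).le
          (Real.exp_lt_one_iff.2 (by linarith))).mul_left _
      set M := (level Δ h).sup size + 1 with hM
      calc ∑ t ∈ level Δ h, wt 0 0 r t
          = ∑ n ∈ Finset.range M, ∑ t ∈ level Δ h with t.size = n, wt 0 0 r t := by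
            refine (Finset.sum_fiberwise_of_maps_to (fun t ht => ?_) _).symm
            have := Finset.le_sup (f := size) ht
            simp; omega
        _ ≤ ∑ n ∈ Finset.range M, 2 * Real.exp lam * Real.exp (lam - r) ^ n := by
            refine Finset.sum_le_sum fun n _ => ?_
            calc ∑ t ∈ level Δ h with t.size = n, wt 0 0 r t
                ≤ ∑ t ∈ treesOfSize Δ n, wt 0 0 r t := by
                  refine Finset.sum_le_sum_of_subset_of_nonneg (fun t ht => ?_)
                    fun t _ _ => (wt_pos ..).le
                  rw [Finset.mem_filter] at ht
                  exact mem_treesOfSize.2 ⟨⟨h, ht.1⟩, ht.2⟩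
              _ = (treesOfSize Δ n).card * Real.exp (-(r * n)) := by
                  rw [← nsmul_eq_mul, ← Finset.sum_const]
                  refine Finset.sum_congr rfl fun t ht => ?_
                  rw [wt, (mem_treesOfSize.1 ht).2]; congr 1; ring
              _ ≤ 2 * Real.exp (lam * (n + 1)) * Real.exp (-(r * n)) := by gcongr; exact hl n
              _ = _ := by
                  rw [← Real.exp_nat_mul, mul_assoc, mul_assoc, ← Real.exp_add, ← Real.exp_add]
                  congr 2; ring
        _ ≤ _ := hsum.sum_le_tsum _ fun n _ => by positivity
    set F := ⨆ h, ∑ t ∈ level Δ h, wt 0 0 r t with hF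
    have hle : ∀ h, ∑ t ∈ level Δ h, wt 0 0 r t ≤ F := fun h => le_ciSup hb h
    by_contra hcon
    push Not at hcon
    have hpos : ∀ h, 0 ≤ ∑ t ∈ level Δ h, wt 0 0 r t :=
      fun h => Finset.sum_nonneg fun _ _ => (wt_pos ..).le
    have hFgt : 2 * Real.exp r < F := hcon.trans_le (hle h)
    have hFpos : 0 < F := lt_trans (by positivity) hFgt
    have hq : F ≤ Real.sqrt (2 * Real.exp r * F) := by
      refine ciSup_le fun h => ?_
      refine Real.le_sqrt_of_sq_le ?_
      have h1 := (sum_level_quadratic hΔ h r).trans (hle (h + 1))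
      rw [Real.exp_neg] at h1
      have he := Real.exp_pos r
      field_simp at h1
      linarith
    rw [Real.le_sqrt hFpos.le (by positivity)] at hq
    nlinarith
  have hc : ∀ t, Continuous fun r => wt 0 0 r t := fun t => by unfold wt; fun_prop
  refine le_of_tendsto_of_tendsto (b := 𝓝[>] lam)
    ((continuous_finsetSum (level Δ h) fun t _ => hc t).continuousAt.tendsto.mono_left
      nhdsWithin_le_nhds)
    (((Real.continuous_exp.const_mul 2).continuousAt (x := lam)).tendsto.mono_left
      nhdsWithin_le_nhds) ?_
  filter_upwards [self_mem_nhdsWithin] with r hr using key r hr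

theorem wt_zero_left (j : ℕ) (r : ℝ) (t : RTree) : wt j 0 r t = wt 0 0 r t := by
  simp [wt]

theorem wt_pow (j : ℕ) (s r : ℝ) (t : RTree) (i : ℕ) : wt j s r t ^ i = wt j (i * s) (i * r) t := by
  rw [wt, wt, ← Real.exp_nat_mul]; congr 1; ring

theorem wt_zero_anti (j : ℕ) {r r' : ℝ} (h : r ≤ r') (t : RTree) : wt j 0 r' t ≤ wt j 0 r t := by
  unfold wt; gcongr

theorem hasFDerivAt_wt (j : ℕ) (t : RTree) (x : ℝ × ℝ) :
    HasFDerivAt (fun x : ℝ × ℝ => wt j x.1 x.2 t)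
      (wt j x.1 x.2 t • ((count j t : ℝ) • ContinuousLinearMap.fst ℝ ℝ ℝ -
        (size t : ℝ) • ContinuousLinearMap.snd ℝ ℝ ℝ)) x := by
  unfold wt
  exact ((hasFDerivAt_fst.mul_const _).sub (hasFDerivAt_snd.mul_const _)).exp

open Classical in
/-- The level sets as finite sets of valid trees. -/
noncomputable def vlevel (Δ h : ℕ) : Finset {t : RTree // Valid Δ t} :=
  (level Δ h).subtype (Valid Δ)

theorem sum_vlevel (Δ h : ℕ) (f : RTree → ℝ) :
    ∑ t ∈ vlevel Δ h, f t = ∑ t ∈ level Δ h, f t := by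
  classical
  exact Finset.sum_subtype_of_mem f fun t ht => ⟨h, ht⟩

theorem tendsto_vlevel (Δ : ℕ) : Tendsto (vlevel Δ) atTop atTop := by
  classical
  refine tendsto_atTop_finset_of_monotone (fun a b hab t ht => ?_) fun t => ?_
  · rw [vlevel, Finset.mem_subtype] at *
    exact level_mono Δ hab ht
  · obtain ⟨h, hh⟩ := t.2
    exact ⟨h, by rw [vlevel, Finset.mem_subtype]; exact hh⟩

/-- The bivariate generating function of valid trees. -/
noncomputable def genFun (Δ j : ℕ) (x : ℝ × ℝ) : ℝ := ∑' t : {t // Valid Δ t}, wt j x.1 x.2 t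

section Critical

variable {Δ j : ℕ} {lam B : ℝ} (hB : ∀ h, ∑ t ∈ level Δ h, wt 0 0 lam t ≤ B)

include hB

theorem summable_wt_critical : Summable fun t : {t // Valid Δ t} => wt j 0 lam t := by
  classical
  refine summable_of_sum_le (c := B) (fun t => (wt_pos ..).le) fun u => ?_
  obtain ⟨h, hh⟩ := ((tendsto_vlevel Δ).eventually (eventually_ge_atTop u)).exists
  refine (Finset.sum_le_sum_of_subset_of_nonneg hh fun _ _ _ => (wt_pos ..).le).trans ?_
  rw [sum_vlevel Δ h (wt j 0 lam)]
  simpa only [wt_zero_left] using hB h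

theorem summable_wt_of_le {r : ℝ} (hr : lam ≤ r) :
    Summable fun t : {t // Valid Δ t} => wt j 0 r t :=
  (summable_wt_critical hB).of_nonneg_of_le (fun _ => (wt_pos ..).le) fun t => wt_zero_anti j hr t

theorem genFun_anti {r r' : ℝ} (hr : lam ≤ r) (h : r ≤ r') :
    genFun Δ j (0, r') ≤ genFun Δ j (0, r) :=
  (summable_wt_of_le hB (hr.trans h)).tsum_le_tsum (fun t => wt_zero_anti j h t)
    (summable_wt_of_le hB hr)

theorem genFun_regular {r₀ : ℝ} (hr : lam < r₀) :
    DifferentiableAt ℝ (genFun Δ j) (0, r₀) ∧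
      ∀ᶠ x in 𝓝 ((0, r₀) : ℝ × ℝ), Summable fun t : {t // Valid Δ t} => wt j x.1 x.2 t := by
  set δ := (r₀ - lam) / 3 with hδ
  have hδ0 : 0 < δ := by rw [hδ]; linarith
  have hu : Summable fun t : {t // Valid Δ t} => 2 / δ * wt j 0 lam t :=
    (summable_wt_critical hB).mul_left _
  have hball : ((0, r₀) : ℝ × ℝ) ∈ Metric.ball ((0, r₀) : ℝ × ℝ) δ := Metric.mem_ball_self hδ0
  have hbound : ∀ (t : {t // Valid Δ t}) (x : ℝ × ℝ), x ∈ Metric.ball ((0, r₀) : ℝ × ℝ) δ →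
      ‖wt j x.1 x.2 t • ((count j t : ℝ) • ContinuousLinearMap.fst ℝ ℝ ℝ -
        (size (t : RTree) : ℝ) • ContinuousLinearMap.snd ℝ ℝ ℝ)‖ ≤ 2 / δ * wt j 0 lam t := by
    rintro ⟨t, -⟩ ⟨s, r⟩ hx
    rw [Metric.mem_ball, Prod.dist_eq, max_lt_iff, Real.dist_eq, Real.dist_eq, sub_zero] at hx
    have hs := abs_lt.1 hx.1
    have hr' := abs_lt.1 hx.2
    have hXN : (count j t : ℝ) ≤ size t := by exact_mod_cast count_le_size j t
    have hX0 : (0 : ℝ) ≤ count j t := Nat.cast_nonneg _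
    have hN0 : (0 : ℝ) ≤ size t := Nat.cast_nonneg _
    have h1 : wt j s r t ≤ wt j 0 lam t * Real.exp (-(δ * size t)) := by
      rw [wt, wt, ← Real.exp_add, Real.exp_le_exp]
      nlinarith
    have h2 : ‖(count j t : ℝ) • ContinuousLinearMap.fst ℝ ℝ ℝ -
        (size t : ℝ) • ContinuousLinearMap.snd ℝ ℝ ℝ‖ ≤ 2 * size t := by
      refine (norm_sub_le _ _).trans ?_
      rw [norm_smul, norm_smul, Real.norm_of_nonneg hX0, Real.norm_of_nonneg hN0]
      have := ContinuousLinearMap.norm_fst_le ℝ ℝ ℝ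
      have := ContinuousLinearMap.norm_snd_le ℝ ℝ ℝ
      nlinarith
    have h3 : size t * Real.exp (-(δ * size t)) ≤ 1 / δ := by
      rw [le_div_iff₀ hδ0, Real.exp_neg, mul_right_comm, ← div_eq_mul_inv,
        div_le_one (Real.exp_pos _)]
      have := Real.add_one_le_exp (δ * size t)
      linarith
    rw [norm_smul, Real.norm_of_nonneg (wt_pos ..).le]
    have hw := (wt_pos j 0 lam t).le
    calc _ ≤ (wt j 0 lam t * Real.exp (-(δ * size t))) * (2 * size t) := by gcongr
      _ = 2 * wt j 0 lam t * (size t * Real.exp (-(δ * size t))) := by ring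
      _ ≤ 2 * wt j 0 lam t * (1 / δ) := by gcongr
      _ = _ := by ring
  have hpre : IsPreconnected (Metric.ball ((0, r₀) : ℝ × ℝ) δ) :=
    (convex_ball _ _).isPreconnected
  have hs0 := summable_wt_of_le (j := j) hB hr.le
  refine ⟨(hasFDerivAt_tsum_of_isPreconnected hu Metric.isOpen_ball hpre
    (fun t x _ => hasFDerivAt_wt j t x) hbound hball hs0 hball).differentiableAt, ?_⟩
  filter_upwards [Metric.ball_mem_nhds _ hδ0] with x hx
  exact summable_of_summable_hasFDerivAt_of_isPreconnected hu Metric.isOpen_ball hpre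
    (fun t x _ => hasFDerivAt_wt j t x) hbound hball hs0 hx

end Critical

theorem newtonH_differentiableAt {p : ℕ → ℝ × ℝ → ℝ} {x : ℝ × ℝ}
    (hp : ∀ i, 1 ≤ i → DifferentiableAt ℝ (p i) x) (k : ℕ) :
    DifferentiableAt ℝ (fun y => newtonH (fun i => p i y) k) x := by
  induction k using Nat.strong_induction_on with
  | _ k ih =>
    cases k with
    | zero => simp only [newtonH]; exact differentiableAt_const _
    | succ k =>
      simp only [newtonH]
      have h : DifferentiableAt ℝ (fun y => ∑ i : Fin (k + 1),
          p (i + 1) y * newtonH (fun i => p i y) (k - i)) x :=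
        DifferentiableAt.fun_sum fun i _ => (hp _ (by omega)).mul (ih _ (by omega))
      simpa only [div_eq_mul_inv] using h.mul_const ((k + 1 : ℝ)⁻¹)

theorem newtonH_tendsto {p : ℕ → ℕ → ℝ} {q : ℕ → ℝ}
    (hp : ∀ i, 1 ≤ i → Tendsto (p i) atTop (𝓝 (q i))) (k : ℕ) :
    Tendsto (fun n => newtonH (fun i => p i n) k) atTop (𝓝 (newtonH q k)) := by
  induction k using Nat.strong_induction_on with
  | _ k ih =>
    cases k with
    | zero => simp only [newtonH]; exact tendsto_const_nhds
    | succ k =>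
      simp only [newtonH]
      exact (tendsto_finsetSum _ fun i _ =>
        (hp _ (by omega)).mul (ih _ (by omega))).div_const _

/-- The power sums entering the fixed point equation, the first one being frozen to `τ`. -/
noncomputable def powerSums (Δ j : ℕ) (τ : ℝ) (x : ℝ × ℝ) (i : ℕ) : ℝ :=
  if i ≤ 1 then τ else genFun Δ j ((i : ℝ) • x)

/-- The right-hand side of the fixed point equation. -/
noncomputable def fixedPointMap (Δ j : ℕ) (τ : ℝ) (x : ℝ × ℝ) : ℝ :=
  ∑ k ∈ Finset.range Δ,
    Real.exp (x.1 * (if k + 1 = j then 1 else 0) - x.2) * newtonH (powerSums Δ j τ x) k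

theorem genFun_nonneg (Δ j : ℕ) (x : ℝ × ℝ) : 0 ≤ genFun Δ j x :=
  tsum_nonneg fun _ => (wt_pos ..).le

theorem powerSums_nonneg {Δ j : ℕ} {τ : ℝ} (hτ : 0 ≤ τ) (x : ℝ × ℝ) (i : ℕ) :
    0 ≤ powerSums Δ j τ x i := by
  unfold powerSums
  split_ifs
  exacts [hτ, genFun_nonneg ..]

/-- Trees are dominated by a supersolution of the fixed point equation. -/
theorem sum_level_le_of_supersolution {Δ j : ℕ} {τ : ℝ} (hτ : 0 ≤ τ) {x : ℝ × ℝ}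
    (hs : ∀ i ∈ Finset.Icc 2 Δ,
      Summable fun t : {t // Valid Δ t} => wt j ((i : ℝ) • x).1 ((i : ℝ) • x).2 t)
    (hx : fixedPointMap Δ j τ x ≤ τ) (h : ℕ) :
    ∑ t ∈ level Δ h, wt j x.1 x.2 t ≤ τ := by
  induction h with
  | zero => simpa [level] using hτ
  | succ h ih =>
    rw [sum_level_succ_wt]
    refine le_trans (Finset.sum_le_sum fun k hk => ?_) hx
    rw [Finset.mem_range] at hk
    gcongr
    rw [hsum_eq_newtonH]
    refine newtonH_mono (fun i => Finset.sum_nonneg fun t _ => pow_nonneg (wt_pos ..).le _) k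
      fun i h1 h2 => ?_
    unfold powerSums
    split_ifs with hi
    · obtain rfl : i = 1 := by omega
      simpa using ih
    · simp_rw [wt_pow]
      rw [← sum_vlevel, genFun]
      exact (hs i (Finset.mem_Icc.2 ⟨by omega, by omega⟩)).sum_le_tsum _
        fun t _ => (wt_pos ..).le

section Critical

variable {Δ j : ℕ} {lam B : ℝ} (hB : ∀ h, ∑ t ∈ level Δ h, wt 0 0 lam t ≤ B)

include hB

theorem fixedPointMap_critical_le (hl : 0 < lam) :
    fixedPointMap Δ j (genFun Δ j (0, lam)) (0, lam) ≤ genFun Δ j (0, lam) := by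
  have hlim : ∀ i : ℕ, 1 ≤ i → Tendsto (fun h => ∑ t ∈ level Δ h, wt j 0 lam t ^ i) atTop
      (𝓝 (powerSums Δ j (genFun Δ j (0, lam)) (0, lam) i)) := by
    intro i hi
    have h1 : lam ≤ i * lam := le_mul_of_one_le_left hl.le (by exact_mod_cast hi)
    have h2 : powerSums Δ j (genFun Δ j (0, lam)) (0, lam) i = genFun Δ j (0, i * lam) := by
      unfold powerSums
      split_ifs with h
      · obtain rfl : i = 1 := by omega
        simp
      · simp
    rw [h2]
    have h3 := (summable_wt_of_le (j := j) hB h1).hasSum.comp (tendsto_vlevel Δ)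
    refine h3.congr fun h => ?_
    simp only [Function.comp]
    rw [sum_vlevel Δ h (wt j 0 (i * lam))]
    simp [wt_pow]
  have h1 := (hlim 1 le_rfl).comp (tendsto_add_atTop_nat 1)
  have e : powerSums Δ j (genFun Δ j (0, lam)) (0, lam) 1 = genFun Δ j (0, lam) := by
    simp [powerSums]
  rw [e] at h1
  refine le_of_tendsto_of_tendsto' (tendsto_finsetSum _ fun k _ =>
    (newtonH_tendsto hlim k).const_mul _) h1 fun h => ?_
  simp only [Function.comp, pow_one]
  rw [sum_level_succ_wt]
  simp only [hsum_eq_newtonH]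
  exact le_rfl

theorem fixedPointMap_differentiableAt (hl : 0 < lam) (τ : ℝ) :
    DifferentiableAt ℝ (fixedPointMap Δ j τ) (0, lam) := by
  unfold fixedPointMap
  refine DifferentiableAt.fun_sum fun k _ => DifferentiableAt.mul (by fun_prop) ?_
  refine newtonH_differentiableAt (p := fun i y => powerSums Δ j τ y i) (fun i hi => ?_) k
  unfold powerSums
  split_ifs with h
  · exact differentiableAt_const _
  · have h2 : (2 : ℝ) ≤ i := by exact_mod_cast by omega
    have h1 : lam < i * lam := by nlinarith
    have h3 := (genFun_regular (j := j) hB h1).1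
    have h4 : DifferentiableAt ℝ (fun y : ℝ × ℝ => (i : ℝ) • y) (0, lam) := by fun_prop
    refine DifferentiableAt.comp (g := genFun Δ j) ((0, lam) : ℝ × ℝ) ?_ h4
    simpa using h3

theorem fixedPointMap_deriv_neg (hΔ : 1 ≤ Δ) (hl : 0 < lam) {τ : ℝ} (hτ : 0 ≤ τ) :
    fderiv ℝ (fixedPointMap Δ j τ) (0, lam) (0, 1) < 0 := by
  set Ψ := fixedPointMap Δ j τ with hΨ
  have hpos : 0 < Ψ (0, lam) := by
    rw [hΨ, fixedPointMap]
    refine lt_of_lt_of_le ?_ (Finset.single_le_sum (fun k _ => mul_nonneg (Real.exp_pos _).le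
      (newtonH_nonneg (powerSums_nonneg hτ _) k)) (Finset.mem_range.2 (show 0 < Δ by omega)))
    rw [newtonH]
    positivity
  have hle : ∀ r : ℝ, 0 ≤ r → Ψ (0, lam + r) ≤ Real.exp (-r) * Ψ (0, lam) := by
    intro r hr
    rw [hΨ, fixedPointMap, fixedPointMap, Finset.mul_sum]
    refine Finset.sum_le_sum fun k _ => ?_
    rw [← mul_assoc, ← Real.exp_add]
    refine mul_le_mul (Real.exp_le_exp.2 (by simp)) ?_
      (newtonH_nonneg (powerSums_nonneg hτ _) k) (Real.exp_pos _).le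
    refine newtonH_mono (powerSums_nonneg hτ _) k fun i h1 _ => ?_
    unfold powerSums
    split_ifs with h
    · exact le_rfl
    · have h2 : (1 : ℝ) ≤ i := by exact_mod_cast h1
      simp only [Prod.smul_mk, smul_eq_mul, mul_zero]
      exact genFun_anti hB (by nlinarith) (by nlinarith)
  have hd : HasDerivAt (fun r : ℝ => Ψ (0, lam + r)) (fderiv ℝ Ψ (0, lam) (0, 1)) 0 := by
    have h1 : HasFDerivAt Ψ (fderiv ℝ Ψ (0, lam)) ((0 : ℝ), lam + 0) := by
      rw [add_zero]; exact (fixedPointMap_differentiableAt hB hl τ).hasFDerivAt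
    have h2 : HasDerivAt (fun r : ℝ => ((0, lam + r) : ℝ × ℝ)) (0, 1) 0 :=
      (hasDerivAt_const _ _).prodMk ((hasDerivAt_id _).const_add _)
    exact h1.comp_hasDerivAt (0 : ℝ) h2
  have he : HasDerivAt (fun r : ℝ => Real.exp (-r) * Ψ (0, lam)) (-Ψ (0, lam)) 0 := by
    have := ((hasDerivAt_neg (0 : ℝ)).exp).mul_const (Ψ (0, lam))
    simpa using this
  have hlim := (hd.sub he).tendsto_slope_zero_right
  have : fderiv ℝ Ψ (0, lam) (0, 1) - -Ψ (0, lam) ≤ 0 := by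
    refine le_of_tendsto hlim ?_
    filter_upwards [self_mem_nhdsWithin] with r hr
    have hr' : (0 : ℝ) < r := hr
    have := hle r hr'.le
    simp only [Pi.sub_apply, zero_add, smul_eq_mul, add_zero, neg_zero, Real.exp_zero, one_mul,
      sub_self, sub_zero]
    exact mul_nonpos_of_nonneg_of_nonpos (by positivity) (by linarith)
  linarith

/-- Along a suitable direction, perturbed weights keep the generating function bounded. -/
theorem exists_slope (hΔ : 1 ≤ Δ) (hl : 0 < lam) : ∃ μ τ : ℝ, 0 ≤ τ ∧ ∀ ε : ℝ, 0 < ε →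
    ∀ᶠ s in 𝓝 (0 : ℝ), ∀ h, ∑ t ∈ level Δ h, wt j s (lam + (μ * s + ε * |s|)) t ≤ τ := by
  set τ := genFun Δ j (0, lam) with hτ
  have hτ0 : 0 ≤ τ := genFun_nonneg ..
  set L := fderiv ℝ (fixedPointMap Δ j τ) (0, lam) with hL
  have hneg : L (0, 1) < 0 := fixedPointMap_deriv_neg hB hΔ hl hτ0
  have hdiff := (fixedPointMap_differentiableAt (j := j) hB hl τ).hasFDerivAt
  refine ⟨-L (1, 0) / L (0, 1), τ, hτ0, fun ε hε => ?_⟩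
  set μ := -L (1, 0) / L (0, 1) with hμ
  have hη : 0 < -ε * L (0, 1) / (1 + |μ| + ε) := by
    apply div_pos _ (by positivity)
    nlinarith
  have h1 := hdiff.isLittleO.def hη
  have h2 : ∀ᶠ x in 𝓝 ((0, lam) : ℝ × ℝ), ∀ i ∈ Finset.Icc 2 Δ,
      Summable fun t : {t // Valid Δ t} => wt j ((i : ℝ) • x).1 ((i : ℝ) • x).2 t := by
    rw [Finset.eventually_all]
    intro i hi
    have h2 : (2 : ℝ) ≤ i := by exact_mod_cast (Finset.mem_Icc.1 hi).1
    have h3 := (genFun_regular (j := j) hB (show lam < i * lam by nlinarith)).2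
    have h4 : Tendsto (fun x : ℝ × ℝ => (i : ℝ) • x) (𝓝 (0, lam)) (𝓝 (0, i * lam)) := by
      have : Continuous fun x : ℝ × ℝ => (i : ℝ) • x := by fun_prop
      simpa using this.tendsto ((0, lam) : ℝ × ℝ)
    exact h4.eventually h3
  have hc : Tendsto (fun s : ℝ => ((s, lam + (μ * s + ε * |s|)) : ℝ × ℝ)) (𝓝 0) (𝓝 (0, lam)) := by
    have : Continuous fun s : ℝ => ((s, lam + (μ * s + ε * |s|)) : ℝ × ℝ) := by fun_prop
    simpa using this.tendsto 0
  filter_upwards [hc.eventually h1, hc.eventually h2] with s hs1 hs2 h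
  refine sum_level_le_of_supersolution hτ0 hs2 ?_ h
  have hsub : ((s, lam + (μ * s + ε * |s|)) : ℝ × ℝ) - (0, lam) = (s, μ * s + ε * |s|) := by
    simp
  rw [hsub] at hs1
  have hLv : L (s, μ * s + ε * |s|) = ε * |s| * L (0, 1) := by
    have : ((s, μ * s + ε * |s|) : ℝ × ℝ) =
        s • ((1, 0) : ℝ × ℝ) + (μ * s + ε * |s|) • ((0, 1) : ℝ × ℝ) := by simp
    rw [this, map_add, map_smul, map_smul, hμ, smul_eq_mul, smul_eq_mul]
    have := hneg.ne
    field_simp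
    ring
  have hnorm : ‖((s, μ * s + ε * |s|) : ℝ × ℝ)‖ ≤ (1 + |μ| + ε) * |s| := by
    rw [Prod.norm_def, max_le_iff, Real.norm_eq_abs, Real.norm_eq_abs]
    have h3 := abs_add_le (μ * s) (ε * |s|)
    rw [abs_mul, abs_mul, abs_abs, abs_of_pos hε] at h3
    have := abs_nonneg s
    have := mul_nonneg (abs_nonneg μ) (abs_nonneg s)
    have := mul_nonneg hε.le (abs_nonneg s)
    constructor <;> nlinarith
  have h4 := (le_abs_self _).trans hs1
  have h5 := mul_le_mul_of_nonneg_left hnorm hη.le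
  rw [hLv] at h4
  have h6 : -ε * L (0, 1) / (1 + |μ| + ε) * ((1 + |μ| + ε) * |s|) = -ε * L (0, 1) * |s| := by
    have : 1 + |μ| + ε ≠ 0 := by positivity
    field_simp
  rw [h6] at h5
  have h7 := fixedPointMap_critical_le (j := j) hB hl
  rw [← hτ] at h7
  linarith

end Critical

open Classical in
/-- Exponential concentration of degree counts in planted trees. -/
theorem exists_planted_concentration {Δ : ℕ} (hΔ : 3 ≤ Δ) (j : ℕ) : ∃ μ : ℝ, ∀ ε : ℝ, 0 < ε →
    ∃ c : ℝ, 0 < c ∧ ∀ᶠ n : ℕ in atTop,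
      (((treesOfSize Δ n).filter fun t => ε * n < |(count j t : ℝ) - μ * n|).card : ℝ) ≤
        Real.exp (-(c * n)) * (treesOfSize Δ n).card := by
  obtain ⟨lam, hl, hup, hlow⟩ := exists_growth_rate hΔ
  obtain ⟨μ, τ, hτ, hμ⟩ := exists_slope (j := j) (sum_level_le_of_growth hΔ hup) (by omega) hl
  refine ⟨μ, fun ε hε => ?_⟩
  obtain ⟨s, hs0, hs⟩ : ∃ s : ℝ, 0 < s ∧ ∀ σ : ℝ, |σ| = s → ∀ h,
      ∑ t ∈ level Δ h, wt j σ (lam + (μ * σ + ε / 2 * |σ|)) t ≤ τ := by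
    obtain ⟨δ, hδ, hb⟩ := Metric.eventually_nhds_iff.1 (hμ (ε / 2) (by positivity))
    refine ⟨δ / 2, by positivity, fun σ hσ => hb ?_⟩
    rw [Real.dist_eq, sub_zero, hσ]; linarith
  have key : ∀ σ : ℝ, |σ| = s → ∀ n : ℕ,
      (((treesOfSize Δ n).filter fun t => s * (ε * n) < σ * ((count j t : ℝ) - μ * n)).card : ℝ) ≤
        τ * Real.exp ((lam - ε / 2 * s) * n) := by
    intro σ hσ n
    have h1 := hs σ hσ n
    rw [hσ] at h1
    have h2 : (((treesOfSize Δ n).filter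
        fun t => s * (ε * n) < σ * ((count j t : ℝ) - μ * n)).card : ℝ) *
        Real.exp (-((lam - ε / 2 * s) * n)) ≤ τ := by
      refine le_trans ?_ h1
      rw [← nsmul_eq_mul, ← Finset.sum_const]
      calc _ ≤ ∑ t ∈ (treesOfSize Δ n).filter
              fun t => s * (ε * n) < σ * ((count j t : ℝ) - μ * n),
              wt j σ (lam + (μ * σ + ε / 2 * s)) t := by
            refine Finset.sum_le_sum fun t ht => ?_
            rw [Finset.mem_filter, mem_treesOfSize] at ht
            rw [wt, ht.1.2, Real.exp_le_exp]
            linarith [ht.2]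
        _ ≤ _ := Finset.sum_le_sum_of_subset_of_nonneg
            ((Finset.filter_subset _ _).trans (Finset.filter_subset _ _))
            fun t _ _ => (wt_pos ..).le
    rwa [Real.exp_neg, ← div_eq_mul_inv, div_le_iff₀ (Real.exp_pos _)] at h2
  refine ⟨ε * s / 4, by positivity, ?_⟩
  have hbig : ∀ᶠ n : ℕ in atTop, 2 * τ ≤ ε * s / 8 * n :=
    (tendsto_natCast_atTop_atTop.const_mul_atTop (by positivity)).eventually_ge_atTop _
  filter_upwards [hlow (ε * s / 8) (by positivity), hbig] with n hn1 hn2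
  have hsub : ((treesOfSize Δ n).filter fun t => ε * n < |(count j t : ℝ) - μ * n|) ⊆
      ((treesOfSize Δ n).filter fun t => s * (ε * n) < s * ((count j t : ℝ) - μ * n)) ∪
      ((treesOfSize Δ n).filter fun t => s * (ε * n) < (-s) * ((count j t : ℝ) - μ * n)) := by
    intro t ht
    rw [Finset.mem_filter, lt_abs] at ht
    rw [Finset.mem_union, Finset.mem_filter, Finset.mem_filter]
    rcases ht with ⟨h1, h2 | h2⟩
    · exact Or.inl ⟨h1, mul_lt_mul_of_pos_left h2 hs0⟩
    · exact Or.inr ⟨h1, by nlinarith⟩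
  have h3 := key s (abs_of_pos hs0) n
  have h4 := key (-s) (by rw [abs_neg, abs_of_pos hs0]) n
  have h5 : (((treesOfSize Δ n).filter fun t => ε * n < |(count j t : ℝ) - μ * n|).card : ℝ) ≤
      2 * τ * Real.exp ((lam - ε / 2 * s) * n) := by
    have := (Finset.card_le_card hsub).trans (Finset.card_union_le _ _)
    have h6 : (((treesOfSize Δ n).filter fun t => ε * n < |(count j t : ℝ) - μ * n|).card : ℝ) ≤
        ((treesOfSize Δ n).filter fun t => s * (ε * n) < s * ((count j t : ℝ) - μ * n)).card +
        ((treesOfSize Δ n).filter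
          fun t => s * (ε * n) < (-s) * ((count j t : ℝ) - μ * n)).card := by
      exact_mod_cast this
    linarith
  have h7 : 2 * τ ≤ Real.exp (ε * s / 8 * n) := by
    have := Real.add_one_le_exp (ε * s / 8 * n)
    linarith
  calc _ ≤ 2 * τ * Real.exp ((lam - ε / 2 * s) * n) := h5
    _ ≤ Real.exp (ε * s / 8 * n) * Real.exp ((lam - ε / 2 * s) * n) := by gcongr
    _ = Real.exp (-(ε * s / 4 * n)) * Real.exp ((lam - ε * s / 8) * n) := by
        rw [← Real.exp_add, ← Real.exp_add]; congr 1; ring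
    _ ≤ _ := by gcongr

theorem exists_matching {α β γ : Type*} [Nonempty β] (F : α → γ) (F' : β → γ) (s : Finset α) :
    ∀ t : Finset β, s.val.map F = t.val.map F' →
      ∃ σ : α → β, (∀ a ∈ s, σ a ∈ t ∧ F a = F' (σ a)) ∧ Set.InjOn σ s := by
  classical
  induction s using Finset.induction_on with
  | empty => exact fun t _ => ⟨fun _ => Classical.arbitrary β, by simp, by simp⟩
  | insert a s ha ih =>
    intro t h
    rw [Finset.insert_val_of_notMem ha, Multiset.map_cons] at h
    have hmem : F a ∈ t.val.map F' := h ▸ Multiset.mem_cons_self _ _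
    obtain ⟨b, hb, hab⟩ := Multiset.mem_map.1 hmem
    have hb' : b ∈ t := hb
    have h2 : s.val.map F = (t.erase b).val.map F' := by
      rw [← Multiset.cons_inj_right (F a), h, Finset.erase_val, ← hab, ← Multiset.map_cons,
        Multiset.cons_erase hb]
    obtain ⟨σ, h3, h4⟩ := ih _ h2
    have hne : ∀ x ∈ s, x ≠ a := fun x hx e => ha (e ▸ hx)
    refine ⟨Function.update σ a b, ?_, ?_⟩
    · intro x hx
      rcases Finset.mem_insert.1 hx with rfl | hx
      · simp [hb', hab]
      · rw [Function.update_of_ne (hne x hx)]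
        exact ⟨Finset.mem_of_mem_erase (h3 x hx).1, (h3 x hx).2⟩
    · intro x hx y hy e
      rw [Finset.coe_insert, Set.mem_insert_iff] at hx hy
      rcases hx with rfl | hx <;> rcases hy with rfl | hy
      · rfl
      · rw [Function.update_self, Function.update_of_ne (hne y hy)] at e
        exact absurd e.symm (Finset.ne_of_mem_erase (h3 y hy).1)
      · rw [Function.update_self, Function.update_of_ne (hne x hx)] at e
        exact absurd e (Finset.ne_of_mem_erase (h3 x hx).1)
      · rw [Function.update_of_ne (hne x hx), Function.update_of_ne (hne y hy)] at e
        exact h4 hx hy e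

section Branch

variable {V : Type*} [Fintype V] (G : SimpleGraph V)

open Classical in
/-- The vertices lying beyond `v` when seen from `u`. -/
noncomputable def branch (u v : V) : Finset V :=
  Finset.univ.filter fun x => G.dist u x = G.dist v x + 1

open Classical in
/-- The neighbours of `v` other than `u`. -/
noncomputable def onward (u v : V) : Finset V := Finset.univ.filter fun w => G.Adj v w ∧ w ≠ u

/-- The rooted tree at `v`, directed away from `u`, unfolded to depth `h`. -/
noncomputable def code : ℕ → V → V → RTree
  | 0, _, _ => mk 0
  | h + 1, u, v => mk ((onward G u v).val.map fun w => code h v w)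

variable {G}

theorem mem_branch {u v x : V} : x ∈ branch G u v ↔ G.dist u x = G.dist v x + 1 := by
  simp [branch]

theorem mem_onward {u v w : V} : w ∈ onward G u v ↔ G.Adj v w ∧ w ≠ u := by
  simp [onward]

theorem card_onward {u v : V} (h : G.Adj u v) :
    (onward G u v).card + 1 = Nat.card {w // G.Adj v w} := by
  classical
  rw [Nat.card_eq_fintype_card, Fintype.card_subtype]
  have : Finset.univ.filter (fun w => G.Adj v w) = insert u (onward G u v) := by
    ext w
    simp only [Finset.mem_filter, Finset.mem_univ, true_and, Finset.mem_insert, mem_onward]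
    constructor
    · intro hw
      by_cases e : w = u
      · exact Or.inl e
      · exact Or.inr ⟨hw, e⟩
    · rintro (rfl | hw)
      exacts [h.symm, hw.1]
  rw [this, Finset.card_insert_of_notMem]
  simp [mem_onward]

theorem notMem_branch_left (u v : V) : u ∉ branch G u v := by
  simp [mem_branch]

theorem mem_branch_right {u v : V} (h : G.Adj u v) : v ∈ branch G u v := by
  simp [mem_branch, SimpleGraph.dist_eq_one_iff_adj.2 h]

theorem branch_unique (hG : G.IsTree) {v w w' x : V} (h : G.Adj v w) (h' : G.Adj v w')
    (hx : x ∈ branch G v w) (hx' : x ∈ branch G v w') : w = w' := by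
  rw [mem_branch] at hx hx'
  obtain ⟨p, hp⟩ := (hG.1 w x).exists_walk_length_eq_dist
  obtain ⟨q, hq⟩ := (hG.1 w' x).exists_walk_length_eq_dist
  have h1 : (SimpleGraph.Walk.cons h p).IsPath :=
    SimpleGraph.Walk.isPath_of_length_eq_dist _ (by simp [hp, hx])
  have h2 : (SimpleGraph.Walk.cons h' q).IsPath :=
    SimpleGraph.Walk.isPath_of_length_eq_dist _ (by simp [hq, hx'])
  have e := (hG.2.subsingleton_path v x).elim ⟨_, h1⟩ ⟨_, h2⟩
  have e' := congrArg (fun p : G.Path v x => p.1.snd) e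
  simpa using e'

theorem exists_mem_branch (hG : G.IsTree) {v x : V} (h : x ≠ v) :
    ∃ w, G.Adj v w ∧ x ∈ branch G v w := by
  obtain ⟨p, hp⟩ := (hG.1 v x).exists_walk_length_eq_dist
  cases p with
  | nil => exact absurd rfl h
  | cons hadj q =>
    rename_i w
    refine ⟨w, hadj, ?_⟩
    rw [mem_branch]
    have h1 := SimpleGraph.dist_le q
    simp only [SimpleGraph.Walk.length_cons] at hp
    have h2 := hG.1.dist_triangle (u := v) (v := w) (w := x)
    rw [SimpleGraph.dist_eq_one_iff_adj.2 hadj] at h2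
    omega

theorem mem_branch_or (hG : G.IsTree) {u v : V} (h : G.Adj u v) (x : V) :
    x ∈ branch G u v ∨ x ∈ branch G v u := by
  rw [mem_branch, mem_branch]
  have := hG.dist_eq_dist_add_one_of_adj x h
  rwa [SimpleGraph.dist_comm (u := x) (v := u), SimpleGraph.dist_comm (u := x) (v := v)] at this

theorem mem_branch_iff (hG : G.IsTree) {u v : V} (h : G.Adj u v) {x : V} :
    x ∈ branch G u v ↔ x = v ∨ ∃ w ∈ onward G u v, x ∈ branch G v w := by
  constructor
  · intro hx
    by_cases e : x = v
    · exact Or.inl e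
    · obtain ⟨w, hw, hxw⟩ := exists_mem_branch hG e
      refine Or.inr ⟨w, mem_onward.2 ⟨hw, ?_⟩, hxw⟩
      rintro rfl
      rw [mem_branch] at hx hxw
      omega
  · rintro (rfl | ⟨w, hw, hxw⟩)
    · exact mem_branch_right h
    · rw [mem_onward] at hw
      rcases mem_branch_or hG h x with h1 | h1
      · exact h1
      · exact absurd (branch_unique hG hw.1 h.symm hxw h1) hw.2

theorem branch_subset (hG : G.IsTree) {u v w : V} (h : G.Adj u v) (hw : w ∈ onward G u v) :
    branch G v w ⊆ branch G u v :=
  fun _ hx => (mem_branch_iff hG h).2 (Or.inr ⟨w, hw, hx⟩)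

theorem card_branch_lt (hG : G.IsTree) {u v w : V} (h : G.Adj u v) (hw : w ∈ onward G u v) :
    (branch G v w).card < (branch G u v).card :=
  Finset.card_lt_card ⟨branch_subset hG h hw,
    fun hc => notMem_branch_left v w (hc (mem_branch_right h))⟩

theorem sum_branch (hG : G.IsTree) {u v : V} (h : G.Adj u v) (f : V → ℕ) :
    ∑ x ∈ branch G u v, f x = f v + ∑ w ∈ onward G u v, ∑ x ∈ branch G v w, f x := by
  classical
  have e : branch G u v = insert v ((onward G u v).biUnion fun w => branch G v w) := by
    ext x
    simp only [mem_branch_iff hG h, Finset.mem_insert, Finset.mem_biUnion]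
  rw [e, Finset.sum_insert, Finset.sum_biUnion]
  · intro w hw w' hw' hne
    rw [Function.onFun, Finset.disjoint_left]
    intro x hx hx'
    exact hne (branch_unique hG (mem_onward.1 hw).1 (mem_onward.1 hw').1 hx hx')
  · simp only [Finset.mem_biUnion, not_exists, not_and]
    exact fun w _ => notMem_branch_left v w

theorem nodeSum_code (hG : G.IsTree) (φ : ℕ → ℕ) (h : ℕ) :
    ∀ {u v : V}, G.Adj u v → (branch G u v).card ≤ h →
      nodeSum φ (code G h u v) = ∑ x ∈ branch G u v, φ (Nat.card {w // G.Adj x w} - 1) := by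
  induction h with
  | zero =>
    intro u v huv hc
    rw [Nat.le_zero, Finset.card_eq_zero] at hc
    exact absurd (mem_branch_right huv) (by simp [hc])
  | succ h ih =>
    intro u v huv hc
    rw [code, nodeSum_mk, sum_branch hG huv, Multiset.card_map, Multiset.map_map,
      ← card_onward huv, Nat.add_sub_cancel]
    congr 1
    refine Finset.sum_congr rfl fun w hw => ?_
    exact ih (mem_onward.1 hw).1 (by have := card_branch_lt hG huv hw; omega)

theorem valid_code {Δ : ℕ} (hdeg : ∀ v, Nat.card {w // G.Adj v w} ≤ Δ) (h : ℕ) :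
    ∀ {u v : V}, G.Adj u v → Valid Δ (code G h u v) := by
  induction h with
  | zero =>
    intro u v huv
    rw [code, valid_mk]
    have := card_onward huv
    have := hdeg v
    exact ⟨by rw [Multiset.card_zero]; omega, by simp⟩
  | succ h ih =>
    intro u v huv
    rw [code, valid_mk, Multiset.card_map]
    have := card_onward huv
    have := hdeg v
    refine ⟨by rw [Finset.card_val]; omega, fun a ha => ?_⟩
    obtain ⟨w, hw, rfl⟩ := Multiset.mem_map.1 ha
    exact ih (mem_onward.1 hw).1

theorem code_iso {W : Type*} [Fintype W] {H : SimpleGraph W} (e : G ≃g H) (h : ℕ) :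
    ∀ u v : V, code H h (e u) (e v) = code G h u v := by
  induction h with
  | zero => intro u v; rfl
  | succ h ih =>
    intro u v
    rw [code, code]
    congr 1
    have : onward H (e u) (e v) = (onward G u v).map e.toEquiv.toEmbedding := by
      ext w
      obtain ⟨x, rfl⟩ := e.surjective w
      simp only [mem_onward, Finset.mem_map]
      constructor
      · rintro ⟨h1, h2⟩
        exact ⟨x, ⟨e.map_adj_iff.1 h1, fun h3 => h2 (h3 ▸ rfl)⟩, rfl⟩
      · rintro ⟨y, ⟨h1, h2⟩, h3⟩
        obtain rfl := e.injective h3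
        exact ⟨e.map_adj_iff.2 h1, fun h4 => h2 (e.injective h4)⟩
    rw [this, Finset.map_val, Multiset.map_map]
    exact Multiset.map_congr rfl fun x _ => ih v x

theorem adj_same_branch (hG : G.IsTree) {v x y w w' : V} (hxy : G.Adj x y)
    (hw : G.Adj v w) (hw' : G.Adj v w') (hx : x ∈ branch G v w) (hy : y ∈ branch G v w') :
    w = w' := by
  by_contra hne
  rcases mem_branch_or hG hw y with h1 | h1
  · exact hne (branch_unique hG hw hw' h1 hy)
  rcases mem_branch_or hG hw' x with h2 | h2
  · exact hne (branch_unique hG hw hw' hx h2)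
  rw [mem_branch] at *
  have h3 := hG.dist_eq_dist_add_one_of_adj v hxy
  have h4 := hG.dist_eq_dist_add_one_of_adj w hxy
  have h5 := hG.dist_eq_dist_add_one_of_adj w' hxy
  omega

theorem exists_hom_of_code_eq {W : Type*} [Fintype W] {H : SimpleGraph W} (hG : G.IsTree)
    (hH : H.IsTree) (h : ℕ) : ∀ (h' : ℕ) {u v : V} {u' v' : W}, G.Adj u v → H.Adj u' v' →
      (branch G u v).card ≤ h → (branch H u' v').card ≤ h' →
      code G h u v = code H h' u' v' →
      ∃ f : V → W, f v = v' ∧ (∀ x ∈ branch G u v, f x ∈ branch H u' v') ∧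
        Set.InjOn f (branch G u v) ∧
        ∀ x ∈ branch G u v, ∀ y ∈ branch G u v, G.Adj x y → H.Adj (f x) (f y) := by
  classical
  induction h with
  | zero =>
    intro h' u v u' v' huv _ hc
    rw [Nat.le_zero, Finset.card_eq_zero] at hc
    exact absurd (mem_branch_right huv) (by simp [hc])
  | succ h ih =>
    intro h' u v u' v' huv huv' hc hc' he
    cases h' with
    | zero =>
      rw [Nat.le_zero, Finset.card_eq_zero] at hc'
      exact absurd (mem_branch_right huv') (by simp [hc'])
    | succ h' =>
      rw [code, code] at he
      have : Nonempty W := ⟨u'⟩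
      obtain ⟨σ, hσ, hσi⟩ := exists_matching _ _ _ _ (mk_injective he)
      have hsub : ∀ w ∈ onward G u v, ∃ f : V → W, f w = σ w ∧
          (∀ x ∈ branch G v w, f x ∈ branch H v' (σ w)) ∧ Set.InjOn f (branch G v w) ∧
          ∀ x ∈ branch G v w, ∀ y ∈ branch G v w, G.Adj x y → H.Adj (f x) (f y) := by
        intro w hw
        refine ih h' (mem_onward.1 hw).1 (mem_onward.1 (hσ w hw).1).1 ?_ ?_ (hσ w hw).2
        · have := card_branch_lt hG huv hw; omega
        · have := card_branch_lt hH huv' (hσ w hw).1; omega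
      choose! F hF1 hF2 hF3 hF4 using hsub
      have hto : ∀ x, ∃ w, x ≠ v → G.Adj v w ∧ x ∈ branch G v w := by
        intro x
        by_cases hx : x = v
        · exact ⟨v, fun h => absurd hx h⟩
        · obtain ⟨w, hw⟩ := exists_mem_branch hG hx
          exact ⟨w, fun _ => hw⟩
      choose next hnext using hto
      have hon : ∀ x ∈ branch G u v, x ≠ v → next x ∈ onward G u v := by
        intro x hx hxv
        obtain ⟨w, hw, hxw⟩ := ((mem_branch_iff hG huv).1 hx).resolve_left hxv
        rwa [branch_unique hG (hnext x hxv).1 (mem_onward.1 hw).1 (hnext x hxv).2 hxw]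
      set f : V → W := fun x => if x = v then v' else F (next x) x with hf
      have hfv : f v = v' := by simp [hf]
      have hfx : ∀ x, x ≠ v → f x = F (next x) x := fun x hx => by simp [hf, hx]
      have hmem : ∀ x ∈ branch G u v, x ≠ v → f x ∈ branch H v' (σ (next x)) := by
        intro x hx hxv
        rw [hfx x hxv]
        exact hF2 _ (hon x hx hxv) x (hnext x hxv).2
      have hroot : ∀ y ∈ branch G u v, G.Adj v y → H.Adj v' (f y) := by
        intro y hy hvy
        have hyv : y ≠ v := hvy.ne'
        have : next y = y :=
          branch_unique hG (hnext y hyv).1 hvy (hnext y hyv).2 (mem_branch_right hvy)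
        have hoy := hon y hy hyv
        rw [hfx y hyv, this]
        rw [this] at hoy
        rw [hF1 y hoy]
        exact (mem_onward.1 (hσ y hoy).1).1
      refine ⟨f, hfv, ?_, ?_, ?_⟩
      · intro x hx
        by_cases hxv : x = v
        · rw [hxv, hfv]; exact mem_branch_right huv'
        · exact branch_subset hH huv' (hσ _ (hon x hx hxv)).1 (hmem x hx hxv)
      · intro x hx y hy hxy
        rw [Finset.mem_coe] at hx hy
        by_cases hxv : x = v <;> by_cases hyv : y = v
        · rw [hxv, hyv]
        · have := hmem y hy hyv
          rw [← hxy, hxv, hfv] at this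
          exact absurd this (notMem_branch_left _ _)
        · have := hmem x hx hxv
          rw [hxy, hyv, hfv] at this
          exact absurd this (notMem_branch_left _ _)
        · have h1 := hmem x hx hxv
          have h2 := hmem y hy hyv
          rw [← hxy] at h2
          have h3 := branch_unique hH (mem_onward.1 (hσ _ (hon x hx hxv)).1).1
            (mem_onward.1 (hσ _ (hon y hy hyv)).1).1 h1 h2
          have h4 := hσi (hon x hx hxv) (hon y hy hyv) h3
          rw [hfx x hxv, hfx y hyv, ← h4] at hxy
          refine hF3 _ (hon x hx hxv) (hnext x hxv).2 ?_ hxy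
          rw [h4]; exact (hnext y hyv).2
      · intro x hx y hy hxy
        by_cases hxv : x = v
        · subst hxv
          rw [hfv]; exact hroot y hy hxy
        by_cases hyv : y = v
        · subst hyv
          rw [hfv]; exact (hroot x hx hxy.symm).symm
        have h1 := adj_same_branch hG hxy (hnext x hxv).1 (hnext y hyv).1 (hnext x hxv).2
          (hnext y hyv).2
        rw [hfx x hxv, hfx y hyv, ← h1]
        refine hF4 _ (hon x hx hxv) x (hnext x hxv).2 y ?_ hxy
        rw [h1]; exact (hnext y hyv).2

end Branch

section Leaf

variable {V : Type*} [Fintype V] {G : SimpleGraph V}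

theorem mem_branch_leaf (hG : G.IsTree) {u v : V} (h : G.Adj u v)
    (hu : ∀ w, G.Adj u w → w = v) {x : V} : x ∈ branch G u v ↔ x ≠ u := by
  constructor
  · rintro hx rfl
    exact notMem_branch_left _ _ hx
  · intro hx
    obtain ⟨w, hw, hxw⟩ := exists_mem_branch hG hx
    rwa [← hu w hw]

theorem card_branch_leaf (hG : G.IsTree) {u v : V} (h : G.Adj u v)
    (hu : ∀ w, G.Adj u w → w = v) : (branch G u v).card + 1 = Fintype.card V := by
  classical
  have : branch G u v = Finset.univ.erase u := by
    ext x; simp [mem_branch_leaf hG h hu]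
  rw [this, Finset.card_erase_of_mem (Finset.mem_univ _), Finset.card_univ]
  have := Fintype.card_pos_iff.2 ⟨u⟩
  omega

theorem size_code_leaf (hG : G.IsTree) {u v : V} (h : G.Adj u v)
    (hu : ∀ w, G.Adj u w → w = v) {k : ℕ} (hk : Fintype.card V ≤ k + 1) :
    size (code G k u v) + 1 = Fintype.card V := by
  have hc := card_branch_leaf hG h hu
  rw [size, nodeSum_code hG _ k h (by omega)]
  simpa using hc

theorem card_degree_eq_count_code (hG : G.IsTree) {u v : V} (h : G.Adj u v)
    (hu : ∀ w, G.Adj u w → w = v) {k : ℕ} (hk : Fintype.card V ≤ k + 1) (j : ℕ) :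
    Nat.card {x // Nat.card {w // G.Adj x w} = j} =
      count j (code G k u v) + if j = 1 then 1 else 0 := by
  classical
  have hc := card_branch_leaf hG h hu
  rw [count, nodeSum_code hG _ k h (by omega), Nat.card_eq_fintype_card, Fintype.card_subtype,
    Finset.card_filter]
  have hb : (Finset.univ : Finset V) = insert u (branch G u v) := by
    ext x
    simp only [Finset.mem_univ, Finset.mem_insert, mem_branch_leaf hG h hu, true_iff]
    exact em _
  have hdu : Nat.card {w // G.Adj u w} = 1 := by
    rw [Nat.card_eq_one_iff_unique]
    exact ⟨⟨fun a b => Subtype.ext ((hu a a.2).trans (hu b b.2).symm)⟩, ⟨⟨v, h⟩⟩⟩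
  rw [hb, Finset.sum_insert (notMem_branch_left u v), hdu, add_comm]
  congr 1
  · refine Finset.sum_congr rfl fun x hx => ?_
    have hxu := (mem_branch_leaf hG h hu).1 hx
    obtain ⟨w, hw, -⟩ := exists_mem_branch hG hxu.symm
    have : 0 < Nat.card {w // G.Adj x w} := by
      rw [Nat.card_pos_iff]; exact ⟨⟨⟨w, hw⟩⟩, inferInstance⟩
    rw [Nat.sub_add_cancel this]
  · simp only [eq_comm]

theorem iso_of_code_eq {W : Type*} [Fintype W] {H : SimpleGraph W} (hG : G.IsTree)
    (hH : H.IsTree) (hVW : Fintype.card V = Fintype.card W) {u v : V} {u' v' : W}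
    (h : G.Adj u v) (hu : ∀ w, G.Adj u w → w = v) (h' : H.Adj u' v')
    (hu' : ∀ w, H.Adj u' w → w = v') {k : ℕ} (hk : Fintype.card V ≤ k + 1)
    (he : code G k u v = code H k u' v') : Nonempty (G ≃g H) := by
  classical
  have hc := card_branch_leaf hG h hu
  have hc' := card_branch_leaf hH h' hu'
  obtain ⟨f, hf1, hf2, hf3, hf4⟩ :=
    exists_hom_of_code_eq hG hH k k h h' (by omega) (by omega) he
  set g : V → W := Function.update f u u' with hg
  have hgu : g u = u' := by simp [hg]
  have hgx : ∀ x, x ≠ u → g x = f x := fun x hx => by simp [hg, hx]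
  have hfu : ∀ x, x ≠ u → f x ≠ u' := fun x hx =>
    (mem_branch_leaf hH h' hu').1 (hf2 x ((mem_branch_leaf hG h hu).2 hx))
  have hinj : Function.Injective g := by
    intro x y hxy
    by_cases hx : x = u <;> by_cases hy : y = u
    · rw [hx, hy]
    · rw [hx, hgu, hgx y hy] at hxy; exact absurd hxy.symm (hfu y hy)
    · rw [hy, hgu, hgx x hx] at hxy; exact absurd hxy (hfu x hx)
    · rw [hgx x hx, hgx y hy] at hxy
      exact hf3 ((mem_branch_leaf hG h hu).2 hx) ((mem_branch_leaf hG h hu).2 hy) hxy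
  have hadj : ∀ x y, G.Adj x y → H.Adj (g x) (g y) := by
    intro x y hxy
    by_cases hx : x = u
    · subst hx
      have := hu y hxy
      subst this
      rw [hgu, hgx y h.ne', hf1]; exact h'
    by_cases hy : y = u
    · subst hy
      have := hu x hxy.symm
      subst this
      rw [hgu, hgx x h.ne', hf1]; exact h'.symm
    rw [hgx x hx, hgx y hy]
    exact hf4 x ((mem_branch_leaf hG h hu).2 hx) y ((mem_branch_leaf hG h hu).2 hy) hxy
  have hbij : Function.Bijective g := (Fintype.bijective_iff_injective_and_card g).2 ⟨hinj, hVW⟩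
  let e : V ≃ W := Equiv.ofBijective g hbij
  have hle : G.map e.toEmbedding ≤ H := by
    rw [SimpleGraph.map_le_iff_le_comap]
    exact fun x y hxy => hadj x y hxy
  have hi : G ≃g G.map e.toEmbedding := SimpleGraph.Iso.map e G
  have hconn : (G.map e.toEmbedding).Connected := hi.connected_iff.1 hG.1
  have heq : G.map e.toEmbedding = H :=
    le_antisymm hle ((SimpleGraph.isTree_iff_minimal_connected.1 hH).2 hconn hle)
  exact ⟨heq ▸ hi⟩

end Leaf

/-- The graph joining every element to its parent. -/
def parentGraph {A : Type*} (par : A → A) : SimpleGraph A :=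
  SimpleGraph.fromRel fun x y => par x = y

theorem isTree_parentGraph {A : Type*} [Fintype A] (r : A) (par : A → A) (len : A → ℕ)
    (hr : par r = r) (hpar : ∀ x, x ≠ r → len (par x) < len x) : (parentGraph par).IsTree := by
  classical
  have hadj : ∀ x, x ≠ r → (parentGraph par).Adj x (par x) := by
    intro x hx
    rw [parentGraph, SimpleGraph.fromRel_adj]
    exact ⟨fun h => by have := hpar x hx; rw [← h] at this; omega, Or.inl rfl⟩
  have hreach : ∀ n x, len x = n → (parentGraph par).Reachable x r := by
    intro n
    induction n using Nat.strong_induction_on with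
    | _ n ih =>
      intro x hx
      by_cases hxr : x = r
      · rw [hxr]
      · exact (hadj x hxr).reachable.trans (ih _ (hx ▸ hpar x hxr) _ rfl)
  have hconn : (parentGraph par).Connected :=
    { preconnected := fun x y => (hreach _ x rfl).trans (hreach _ y rfl).symm
      nonempty := ⟨r⟩ }
  rw [SimpleGraph.isTree_iff_connected_and_card]
  refine ⟨hconn, le_antisymm ?_ hconn.card_vert_le_card_edgeSet_add_one⟩
  have hsub : (parentGraph par).edgeSet ⊆
      ((Finset.univ.erase r).image fun x => s(x, par x) : Finset (Sym2 A)) := by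
    intro e
    induction e using Sym2.ind with
    | _ x y =>
      rw [SimpleGraph.mem_edgeSet, parentGraph, SimpleGraph.fromRel_adj]
      rintro ⟨hne, h⟩
      rw [Finset.coe_image]
      rcases h with h | h
      · refine ⟨x, ?_, by simp [h]⟩
        simp only [Finset.coe_erase, Finset.coe_univ, Set.mem_sdiff, Set.mem_univ, true_and,
          Set.mem_singleton_iff]
        rintro rfl
        exact hne (hr.symm.trans h)
      · refine ⟨y, ?_, by simp [h, Sym2.eq_swap]⟩
        simp only [Finset.coe_erase, Finset.coe_univ, Set.mem_sdiff, Set.mem_univ, true_and,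
          Set.mem_singleton_iff]
        rintro rfl
        exact hne (h.symm.trans hr)
  have h1 := Set.ncard_le_ncard hsub (Finset.finite_toSet _)
  rw [Set.ncard_coe_finset] at h1
  have h2 := Finset.card_image_le (s := Finset.univ.erase r) (f := fun x => s(x, par x))
  rw [Finset.card_erase_of_mem (Finset.mem_univ _), Finset.card_univ] at h2
  rw [Nat.card_coe_set_eq, Nat.card_eq_fintype_card]
  have := Fintype.card_pos_iff.2 ⟨r⟩
  omega

/-- The subtree found at a given address; the head of the list is the last step. -/
noncomputable def subtree (t : RTree) : List ℕ → Option RTree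
  | [] => some t
  | i :: l => (subtree t l).bind fun d => d.children.toList[i]?

theorem subtree_mk_append (m : Multiset RTree) (i : ℕ) (l : List ℕ) :
    subtree (mk m) (l ++ [i]) = m.toList[i]?.bind fun d => subtree d l := by
  induction l with
  | nil => simp [subtree]
  | cons k l ih =>
    rw [List.cons_append, subtree, ih]
    cases m.toList[i]? <;> simp [subtree]

theorem finite_addresses (t : RTree) : {l | (subtree t l).isSome}.Finite := by
  induction t using RTree.ind with
  | h m ih =>
    have hf : ({[]} ∪ ⋃ i : Fin m.toList.length,
        (· ++ [(i : ℕ)]) '' {l | (subtree m.toList[i] l).isSome}).Finite := by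
      refine (Set.finite_singleton _).union (Set.finite_iUnion fun i => Set.Finite.image _ ?_)
      exact ih _ (Multiset.mem_toList.1 (List.getElem_mem _))
    refine hf.subset fun l hl => ?_
    rcases List.eq_nil_or_concat' l with rfl | ⟨l, i, rfl⟩
    · exact Or.inl rfl
    · right
      rw [Set.mem_ofPred_eq, subtree_mk_append] at hl
      by_cases hi : i < m.toList.length
      · rw [List.getElem?_eq_getElem hi, Option.bind_some] at hl
        exact Set.mem_iUnion.2 ⟨⟨i, hi⟩, l, hl, rfl⟩
      · rw [List.getElem?_eq_none (by omega)] at hl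
        simp at hl

/-- The nodes of a tree, given by their addresses. -/
def Node (t : RTree) : Type := {l : List ℕ // (subtree t l).isSome}

noncomputable instance (t : RTree) : Fintype (Node t) := (finite_addresses t).fintype

namespace Node

variable {t : RTree}

/-- The subtree rooted at a node. -/
noncomputable def label (x : Node t) : RTree := (subtree t x.1).get x.2

theorem subtree_eq (x : Node t) : subtree t x.1 = some x.label := (Option.some_get x.2).symm

/-- The root of a tree. -/
def root (t : RTree) : Node t := ⟨[], rfl⟩

theorem label_root : (root t).label = t := rfl

/-- The parent of a node, the root being its own parent. -/
def parent (x : Node t) : Node t :=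
  ⟨x.1.tail, by
    obtain ⟨l, hl⟩ := x
    cases l with
    | nil => rfl
    | cons i l =>
      rw [subtree] at hl
      exact Option.isSome_of_isSome_bind hl⟩

/-- The `i`-th child of a node. -/
noncomputable def child (x : Node t) (i : Fin x.label.children.toList.length) : Node t :=
  ⟨i :: x.1, by
    rw [subtree, subtree_eq, Option.bind_some, List.getElem?_eq_getElem i.2]; rfl⟩

theorem label_child (x : Node t) (i : Fin x.label.children.toList.length) :
    (x.child i).label = x.label.children.toList.get i := by
  have h := (x.child i).subtree_eq
  have h1 : subtree t (x.child i).1 = x.label.children.toList[(i : ℕ)]? := by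
    change ((subtree t x.1).bind fun d => d.children.toList[(i : ℕ)]?) = _
    rw [subtree_eq, Option.bind_some]
  rw [h1, List.getElem?_eq_getElem i.2] at h
  exact (Option.some_injective _ h).symm

theorem child_ne_root (x : Node t) (i : Fin x.label.children.toList.length) :
    x.child i ≠ root t := fun h => by simpa [child, root] using congrArg Subtype.val h

theorem child_injective (x : Node t) : Function.Injective x.child := fun i j h => by
  have := congrArg Subtype.val h
  simp only [child, List.cons.injEq, and_true] at this
  exact Fin.ext this

theorem parent_root : (root t).parent = root t := rfl

theorem length_parent_lt {x : Node t} (h : x ≠ root t) : x.parent.1.length < x.1.length := by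
  obtain ⟨l, hl⟩ := x
  cases l with
  | nil => exact absurd rfl h
  | cons i l => simp [parent]

theorem exists_eq_child {x : Node t} (h : x ≠ root t) : ∃ i, x = x.parent.child i := by
  obtain ⟨l, hl⟩ := x
  cases l with
  | nil => exact absurd rfl h
  | cons i l =>
    have hil := hl
    set y : Node t := parent ⟨i :: l, hl⟩ with hy
    have e : subtree t l = some y.label := y.subtree_eq
    rw [subtree, e, Option.bind_some] at hil
    exact ⟨⟨i, by simpa using hil⟩, rfl⟩

/-- The underlying graph of a rooted tree. -/
def graph (t : RTree) : SimpleGraph (Node t) := parentGraph (parent (t := t))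

theorem isTree_graph (t : RTree) : (graph t).IsTree :=
  isTree_parentGraph (root t) parent (fun x => x.1.length) parent_root fun _ => length_parent_lt

theorem graph_adj {x y : Node t} :
    (graph t).Adj x y ↔ (x ≠ root t ∧ x.parent = y) ∨ ∃ i, y = x.child i := by
  rw [graph, parentGraph, SimpleGraph.fromRel_adj]
  constructor
  · rintro ⟨hne, h | h⟩
    · refine Or.inl ⟨?_, h⟩
      rintro rfl
      exact hne h
    · right
      have hy : y ≠ root t := by
        rintro rfl
        exact hne h.symm
      subst h
      exact exists_eq_child hy
  · rintro (⟨h, rfl⟩ | ⟨i, rfl⟩)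
    · exact ⟨fun e => absurd (congrArg (fun z : Node t => z.1.length) e)
        (length_parent_lt h).ne', Or.inl rfl⟩
    · exact ⟨fun e => absurd (congrArg (fun z : Node t => z.1.length) e)
        (by simp [child]), Or.inr rfl⟩

theorem onward_parent {x : Node t} (h : x ≠ root t) :
    onward (graph t) x.parent x = Finset.univ.map ⟨x.child, x.child_injective⟩ := by
  ext w
  simp only [mem_onward, graph_adj, Finset.mem_map, Finset.mem_univ, true_and,
    Function.Embedding.coeFn_mk]
  constructor
  · rintro ⟨⟨-, h1⟩ | ⟨i, h1⟩, h2⟩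
    · exact absurd h1.symm h2
    · exact ⟨i, h1.symm⟩
  · rintro ⟨i, rfl⟩
    refine ⟨Or.inr ⟨i, rfl⟩, fun e => ?_⟩
    have h1 := congrArg (fun z : Node t => z.1.length) e
    have h2 := length_parent_lt h
    simp only [child, List.length_cons] at h1
    omega

theorem code_graph (h : ℕ) : ∀ x : Node t, x ≠ root t → x.label.size ≤ h →
    code (graph t) h x.parent x = x.label := by
  induction h with
  | zero =>
    intro x _ hs
    have := size_pos x.label
    omega
  | succ h ih =>
    intro x hx hs
    rw [code, onward_parent hx, Finset.map_val, Multiset.map_map]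
    conv_rhs => rw [← mk_children x.label]
    congr 1
    have hcode : ∀ i, code (graph t) h x (x.child i) = x.label.children.toList.get i := by
      intro i
      rw [← label_child]
      refine ih (x.child i) (x.child_ne_root i) ?_
      have : (x.child i).label ∈ x.label.children := by
        rw [label_child]
        exact Multiset.mem_toList.1 (List.get_mem _ _)
      have := size_lt_of_mem this
      rw [mk_children] at this
      omega
    refine (Multiset.map_congr rfl fun i _ => hcode i).trans ?_
    conv_rhs => rw [← Multiset.coe_toList x.label.children]
    rw [Fin.univ_val_map, List.ofFn_get]

theorem valid_label {Δ : ℕ} (ht : Valid Δ t) (n : ℕ) :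
    ∀ x : Node t, x.1.length = n → Valid Δ x.label := by
  induction n with
  | zero =>
    intro x hx
    obtain rfl : x = root t := Subtype.ext (List.length_eq_zero_iff.1 hx)
    exact ht
  | succ n ih =>
    intro x hx
    have hr : x ≠ root t := by
      rintro rfl
      simp [root] at hx
    have hp := ih x.parent (by simp [parent, hx])
    obtain ⟨i, hi⟩ := exists_eq_child hr
    rw [hi, label_child]
    rw [← mk_children x.parent.label, valid_mk] at hp
    exact hp.2 _ (Multiset.mem_toList.1 (List.get_mem _ _))

/-- The only neighbour of the root of a tree with a single branch. -/
noncomputable def stem (c : RTree) : Node (mk {c}) :=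
  (root (mk {c})).child ⟨0, by simp [label_root]⟩

theorem eq_stem {c : RTree} (i) : (root (mk {c})).child i = stem c := by
  have h : (root (mk {c})).label.children.toList.length = 1 := by simp [label_root]
  rw [stem]
  congr 1
  exact Fin.ext (by omega)

theorem label_stem (c : RTree) : (stem c).label = c := by
  have h : (stem c).label ∈ (root (mk {c})).label.children := by
    rw [stem, label_child]
    exact Multiset.mem_toList.1 (List.get_mem _ _)
  simpa [label_root] using h

theorem root_adj_iff {c : RTree} {w : Node (mk {c})} :
    (graph (mk {c})).Adj (root _) w ↔ w = stem c := by
  rw [graph_adj]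
  constructor
  · rintro (⟨h, -⟩ | ⟨i, rfl⟩)
    · exact absurd rfl h
    · exact eq_stem i
  · rintro rfl
    exact Or.inr ⟨_, rfl⟩

theorem degree_graph_le {Δ : ℕ} (hΔ : 2 ≤ Δ) {c : RTree} (hc : Valid Δ c) (x : Node (mk {c})) :
    Nat.card {w // (graph (mk {c})).Adj x w} ≤ Δ := by
  by_cases hx : x = root _
  · subst hx
    simp only [root_adj_iff, Nat.card_unique]
    omega
  · have hadj : (graph (mk {c})).Adj x.parent x := (graph_adj.2 (Or.inl ⟨hx, rfl⟩)).symm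
    have ht : Valid Δ (mk {c}) := valid_mk.2 ⟨by rw [Multiset.card_singleton]; omega, by simpa⟩
    have hv := valid_label ht _ x rfl
    rw [← mk_children x.label, valid_mk] at hv
    rw [← card_onward hadj, onward_parent hx, Finset.card_map, Finset.card_univ, Fintype.card_fin,
      Multiset.length_toList]
    exact hv.1

end Node

open Node in
theorem exists_code_eq {Δ n : ℕ} (hΔ : 2 ≤ Δ) {c : RTree} (hc : Valid Δ c) (hn : c.size + 1 = n) :
    ∃ (G : DTree Δ n) (u v : Fin n), code G.1 n u v = c := by
  have hadj : (graph (mk {c})).Adj (root _) (stem c) := root_adj_iff.2 rfl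
  have hcode : ∀ h, c.size ≤ h → code (graph (mk {c})) h (root _) (stem c) = c := by
    intro h hh
    have := code_graph h (stem c) (child_ne_root _ _) (by rwa [label_stem])
    rwa [label_stem] at this
  have hcard : Fintype.card (Node (mk {c})) = n := by
    have := size_code_leaf (k := max c.size (Fintype.card (Node (mk {c})))) (isTree_graph _) hadj
      (fun w hw => root_adj_iff.1 hw) (by omega)
    rw [hcode _ (le_max_left _ _)] at this
    omega
  let e : Node (mk {c}) ≃ Fin n := Fintype.equivFinOfCardEq hcard
  let f : graph (mk {c}) ≃g (graph (mk {c})).map e.toEmbedding := SimpleGraph.Iso.map e _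
  refine ⟨⟨(graph (mk {c})).map e.toEmbedding, f.isTree_iff.1 (isTree_graph _), fun v => ?_⟩,
    f (root _), f (stem c), ?_⟩
  · obtain ⟨x, rfl⟩ := f.surjective v
    refine le_trans (le_of_eq ?_) (degree_graph_le hΔ hc x)
    exact Nat.card_congr (f.toEquiv.subtypeEquiv fun w => f.map_adj_iff.symm).symm
  · rw [code_iso]
    exact hcode n (by omega)

theorem exists_planting {Δ m : ℕ} (hm : 1 ≤ m) :
    ∃ F : TClass Δ (m + 1) → RTree, Function.Injective F ∧ (∀ c, F c ∈ treesOfSize Δ m) ∧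
      ∀ j c, Xdeg Δ (m + 1) j c = count j (F c) + if j = 1 then 1 else 0 := by
  classical
  have : Nontrivial (Fin (m + 1)) := Fin.nontrivial_iff_two_le.2 (by omega)
  have hleaf : ∀ c : TClass Δ (m + 1), ∃ u v, (Quotient.out c).1.Adj u v ∧
      ∀ w, (Quotient.out c).1.Adj u w → w = v := by
    intro c
    obtain ⟨u, hu⟩ := (Quotient.out c).2.1.exists_vert_degree_one_of_nontrivial
    obtain ⟨v, hv, huniq⟩ := (SimpleGraph.degree_eq_one_iff_existsUnique_adj).1 hu
    exact ⟨u, v, hv, huniq⟩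
  choose u v huv hu using hleaf
  have hk : Fintype.card (Fin (m + 1)) ≤ m + 1 := by simp
  refine ⟨fun c => code (Quotient.out c).1 m (u c) (v c), fun c d hcd => ?_, fun c => ?_,
    fun j c => ?_⟩
  · have := iso_of_code_eq (Quotient.out c).2.1 (Quotient.out d).2.1 rfl (huv c) (hu c) (huv d)
      (hu d) hk hcd
    exact Quotient.out_equiv_out.1 this
  · refine mem_treesOfSize.2 ⟨valid_code (Quotient.out c).2.2 m (huv c), ?_⟩
    have := size_code_leaf (Quotient.out c).2.1 (huv c) (hu c) hk
    rw [Fintype.card_fin] at this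
    exact Nat.succ_injective this
  · exact card_degree_eq_count_code (Quotient.out c).2.1 (huv c) (hu c) hk j

theorem card_treesOfSize_le_mul_card_TClass {Δ m : ℕ} (hΔ : 2 ≤ Δ) :
    (treesOfSize Δ m).card ≤ (m + 1) ^ 2 * Nat.card (TClass Δ (m + 1)) := by
  classical
  have : Fintype (TClass Δ (m + 1)) := Fintype.ofFinite _
  let F : TClass Δ (m + 1) × Fin (m + 1) × Fin (m + 1) → RTree :=
    fun x => code (Quotient.out x.1).1 (m + 1) x.2.1 x.2.2
  have hsub : treesOfSize Δ m ⊆ Finset.univ.image F := by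
    intro t ht
    obtain ⟨hv, hs⟩ := mem_treesOfSize.1 ht
    obtain ⟨G, u, v, rfl⟩ := exists_code_eq (n := m + 1) hΔ hv (by omega)
    obtain ⟨e⟩ : Nonempty (G.1 ≃g (Quotient.out (⟦G⟧ : TClass Δ (m + 1))).1) :=
      Setoid.symm (Quotient.mk_out G)
    exact Finset.mem_image.2 ⟨(⟦G⟧, e u, e v), Finset.mem_univ _, code_iso e _ u v⟩
  refine (Finset.card_le_card hsub).trans (Finset.card_image_le.trans (le_of_eq ?_))
  rw [Finset.card_univ, Fintype.card_prod, Fintype.card_prod, Fintype.card_fin,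
    Nat.card_eq_fintype_card]
  ring

theorem tendsto_sq_mul_exp_neg {c : ℝ} (hc : 0 < c) :
    Tendsto (fun m : ℕ => ((m : ℝ) + 1) ^ 2 * Real.exp (-(c * m))) atTop (𝓝 0) := by
  have h1 := (Real.tendsto_pow_mul_exp_neg_atTop_nhds_zero 2).comp
    ((tendsto_natCast_atTop_atTop (R := ℝ)).atTop_add (tendsto_const_nhds (x := (1 : ℝ)))
      |>.const_mul_atTop hc)
  have h2 := h1.const_mul ((c ^ 2)⁻¹ * Real.exp c)
  rw [mul_zero] at h2
  refine h2.congr fun m => ?_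
  simp only [Function.comp]
  have : Real.exp (-(c * m)) = Real.exp c * Real.exp (-(c * (m + 1))) := by
    rw [← Real.exp_add]; ring_nf
  rw [this]
  field_simp

theorem prob_ge {Δ m : ℕ} (hΔ : 2 ≤ Δ) (hm : 1 ≤ m) (j : ℕ) {μ ε c : ℝ}
    (hε : 2 * (1 + |μ|) ≤ ε * m)
    (h : (((treesOfSize Δ m).filter fun t => ε / 2 * m < |(count j t : ℝ) - μ * m|).card : ℝ)
      ≤ Real.exp (-(c * m)) * (treesOfSize Δ m).card) :
    1 - ((m : ℝ) + 1) ^ 2 * Real.exp (-(c * m)) ≤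
      prob Δ (m + 1)
        (fun x => |(Xdeg Δ (m + 1) j x : ℝ) - μ * (m + 1 : ℕ)| ≤ ε * (m + 1 : ℕ)) := by
  classical
  obtain ⟨F, hF, hmem, hX⟩ := exists_planting (Δ := Δ) hm
  have : Fintype (TClass Δ (m + 1)) := Fintype.ofFinite _
  set P : TClass Δ (m + 1) → Prop :=
    fun x => |(Xdeg Δ (m + 1) j x : ℝ) - μ * (m + 1 : ℕ)| ≤ ε * (m + 1 : ℕ) with hP
  have hcard := card_treesOfSize_le_mul_card_TClass (m := m) hΔ
  have hbad : (Finset.univ.filter fun x => ¬ P x).card ≤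
      ((treesOfSize Δ m).filter fun t => ε / 2 * m < |(count j t : ℝ) - μ * m|).card := by
    refine Finset.card_le_card_of_injOn F (fun x hx => ?_) hF.injOn
    have hx' : ¬ P x := (Finset.mem_filter.1 hx).2
    refine Finset.mem_filter.2 ⟨hmem x, ?_⟩
    by_contra! hcon
    refine hx' ?_
    rw [hP]
    simp only [hX j x]
    push_cast
    have hδ0 : (0 : ℝ) ≤ if j = 1 then 1 else 0 := by split_ifs <;> norm_num
    have hδ1 : (if j = 1 then 1 else 0 : ℝ) ≤ 1 := by split_ifs <;> norm_num
    generalize (if j = 1 then 1 else 0 : ℝ) = δ at hδ0 hδ1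
    have hε0 : 0 ≤ ε := by
      have hm' : (0 : ℝ) < m := by exact_mod_cast hm
      by_contra! hneg
      nlinarith [abs_nonneg μ]
    obtain ⟨h1, h2⟩ := abs_le.1 hcon
    rw [abs_le]
    constructor <;> nlinarith [neg_abs_le μ, le_abs_self μ]
  have hsplit := Finset.card_filter_add_card_filter_not
    (s := (Finset.univ : Finset (TClass Δ (m + 1)))) P
  rw [Finset.card_univ] at hsplit
  have hTpos : 0 < Fintype.card (TClass Δ (m + 1)) := by
    obtain ⟨k, rfl⟩ : ∃ k, m = k + 1 := ⟨m - 1, by omega⟩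
    have h1 := one_le_card_treesOfSize hΔ k
    rw [Nat.card_eq_fintype_card] at hcard
    exact Nat.pos_of_ne_zero fun h0 => by rw [h0] at hcard; omega
  rw [prob, Nat.card_eq_fintype_card, Nat.card_eq_fintype_card, Fintype.card_subtype,
    le_div_iff₀ (by exact_mod_cast hTpos)]
  rw [Nat.card_eq_fintype_card] at hcard
  have h1 : ((treesOfSize Δ m).card : ℝ) ≤ ((m : ℝ) + 1) ^ 2 * Fintype.card (TClass Δ (m + 1)) := by
    exact_mod_cast hcard
  have h2 : ((Finset.univ.filter fun x => P x).card : ℝ) + (Finset.univ.filter fun x => ¬ P x).card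
      = Fintype.card (TClass Δ (m + 1)) := by exact_mod_cast hsplit
  have h3 : ((Finset.univ.filter fun x => ¬ P x).card : ℝ) ≤
      Real.exp (-(c * m)) * (treesOfSize Δ m).card := by
    refine le_trans (Nat.cast_le.2 hbad) (le_trans (le_of_eq ?_) h)
    congr
  have h4 := mul_le_mul_of_nonneg_left h1 (Real.exp_pos (-(c * m))).le
  linarith

theorem prob_le_one {Δ n : ℕ} (P : TClass Δ n → Prop) : prob Δ n P ≤ 1 :=
  div_le_one_of_le₀ (by exact_mod_cast Finite.card_subtype_le P) (Nat.cast_nonneg _)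

/-- For `3 ≤ Δ` and `1 ≤ j ≤ Δ`, there is a constant `μ_j` such that for every
`ε > 0`, the probability that the number of vertices of degree `j` in a uniformly random
isomorphism class of `Δ`-trees of order `n` differs from `μ_j·n` by at most `ε·n` tends to `1`. -/
theorem degree_count_concentration (Δ j : ℕ) (hΔ : 3 ≤ Δ) (hj : 1 ≤ j) (hjΔ : j ≤ Δ) :
    ∃ μ : ℝ, ∀ ε : ℝ, 0 < ε →
      Tendsto
        (fun n : ℕ => prob Δ n (fun c => |(Xdeg Δ n j c : ℝ) - μ * n| ≤ ε * n))
        atTop (𝓝 1) := by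
  obtain ⟨μ, hμ⟩ := exists_planted_concentration hΔ j
  refine ⟨μ, fun ε hε => ?_⟩
  obtain ⟨c, hc, hcount⟩ := hμ (ε / 2) (by positivity)
  rw [← tendsto_add_atTop_iff_nat 1]
  have hlow : Tendsto (fun m : ℕ => 1 - ((m : ℝ) + 1) ^ 2 * Real.exp (-(c * m))) atTop (𝓝 1) := by
    simpa using (tendsto_sq_mul_exp_neg hc).const_sub 1
  have hlarge : ∀ᶠ m : ℕ in atTop, 2 * (1 + |μ|) ≤ ε * m :=
    ((tendsto_natCast_atTop_atTop (R := ℝ)).const_mul_atTop hε).eventually_ge_atTop _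
  refine tendsto_of_tendsto_of_tendsto_of_le_of_le' hlow tendsto_const_nhds ?_
    (Eventually.of_forall fun m => prob_le_one _)
  filter_upwards [hcount, hlarge, eventually_ge_atTop 1] with m h1 h2 h3
  exact prob_ge (by omega) h3 j h2 (by convert h1)

end TreePaper
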